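/- Let I ⊂ ℝ be a compact interval, f = (f₁,…,f_n) : I → ℝⁿ a C^(n) map whose Wronskian det(f_i^(j)(x))_{1≤i,j≤n} is nonzero for every x ∈ I, and λ ∈ C²(I). Then the system (R_λ, H) is locally ubiquitous in I with respect to ρ(q) = q^{−n−1}: there exists a constant k > 0 such that for every subinterval J ⊆ I, liminf_{t→∞} | (⋃_{α ∈ R_λ, H(α) ≤ 2^t} B(α, 2^{−t(n+1)})) ∩ J | ≥ k|J|, where B(α,r) is the interval of radius r centred at α and |·| is Lebesgue measure. -/

import Mathlib

open MeasureTheory Filter Set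

/-- A set of large measure contains many well-separated points. -/
theorem exists_separated_points {d : ℝ} (hd : 0 < d) (N : ℕ) :
    ∀ E : Set ℝ, BddBelow E → ENNReal.ofReal (N * (2 * d)) < volume E →
      ∃ x : ℕ → ℝ, (∀ i ≤ N, x i ∈ E) ∧ ∀ i < N, x i + d ≤ x (i + 1) := by
  induction N with
  | zero =>
    intro E _ hE
    obtain ⟨y, hy⟩ : E.Nonempty := nonempty_of_measure_ne_zero (ne_bot_of_gt hE)
    exact ⟨fun _ => y, fun _ _ => hy, fun i hi => absurd hi (by omega)⟩
  | succ N ih =>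
    intro E hb hE
    have hne : E.Nonempty := nonempty_of_measure_ne_zero (ne_bot_of_gt hE)
    obtain ⟨x₀, hx₀, hlt⟩ := exists_lt_of_csInf_lt hne (show sInf E < sInf E + d by linarith)
    have hsub : E ⊆ Icc (sInf E) (sInf E + 2 * d) ∪ (E ∩ Ici (x₀ + d)) := by
      intro z hz
      by_cases h : x₀ + d ≤ z
      · exact Or.inr ⟨hz, h⟩
      · exact Or.inl ⟨csInf_le hb hz, by linarith⟩
    have hE' : ENNReal.ofReal (N * (2 * d)) < volume (E ∩ Ici (x₀ + d)) := by
      by_contra! hcon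
      have h1 : volume E ≤ ENNReal.ofReal (2 * d) + ENNReal.ofReal (N * (2 * d)) := by
        refine (measure_mono hsub).trans ((measure_union_le _ _).trans ?_)
        refine add_le_add ?_ hcon
        rw [Real.volume_Icc]
        exact ENNReal.ofReal_le_ofReal (by linarith)
      rw [← ENNReal.ofReal_add (by positivity) (by positivity)] at h1
      refine absurd (hE.trans_le h1) (not_lt.mpr (ENNReal.ofReal_le_ofReal ?_))
      push_cast
      linarith
    obtain ⟨x, hx, hsep⟩ := ih _ (hb.mono inter_subset_left) hE'
    refine ⟨fun i => Nat.casesOn i x₀ x, ?_, ?_⟩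
    · rintro (_ | i) hi
      · exact hx₀
      · exact (hx i (by omega)).1
    · rintro (_ | i) hi
      · exact (hx 0 (by omega)).2
      · exact hsep i (by omega)

section DerivativeChain

variable {G : ℕ → ℝ → ℝ} {p q : ℝ} {k : ℕ}

/-- If a function is small at `2 ^ k` separated points, then each of its first `k` derivatives
is small somewhere. -/
theorem exists_deriv_small
    (hG : ∀ j < k, ∀ x ∈ Icc p q, HasDerivWithinAt (G j) (G (j + 1) x) (Icc p q) x)
    {d ε : ℝ} (hd : 0 < d) {x : ℕ → ℝ} (hx : ∀ i < 2 ^ k, x i ∈ Icc p q)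
    (hsep : ∀ i, i + 1 < 2 ^ k → x i + d ≤ x (i + 1))
    (hsmall : ∀ i < 2 ^ k, |G 0 (x i)| ≤ ε) {j : ℕ} (hj : j ≤ k) :
    ∃ y ∈ Icc p q, |G j y| ≤ (2 / d) ^ j * ε := by
  suffices H : ∀ j ≤ k, ∃ x : ℕ → ℝ, (∀ i < 2 ^ (k - j), x i ∈ Icc p q) ∧
      (∀ i, i + 1 < 2 ^ (k - j) → x i + d ≤ x (i + 1)) ∧
      ∀ i < 2 ^ (k - j), |G j (x i)| ≤ (2 / d) ^ j * ε by
    obtain ⟨y, h1, -, h3⟩ := H j hj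
    exact ⟨y 0, h1 0 (by positivity), h3 0 (by positivity)⟩
  intro j
  induction j with
  | zero => exact fun _ => ⟨x, by simpa using hx, by simpa using hsep, by simpa using hsmall⟩
  | succ j ih =>
    intro hj
    obtain ⟨x, hx, hsep, hsmall⟩ := ih (by omega)
    have hpow : 2 ^ (k - j) = 2 * 2 ^ (k - (j + 1)) := by
      rw [← pow_succ']
      congr 1
      omega
    have key : ∀ i, ∃ y, i < 2 ^ (k - (j + 1)) →
        y ∈ Ioo (x (2 * i)) (x (2 * i + 1)) ∧ |G (j + 1) y| ≤ (2 / d) ^ (j + 1) * ε := by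
      intro i
      by_cases hi : i < 2 ^ (k - (j + 1))
      swap
      · exact ⟨0, fun h => absurd h hi⟩
      have hs := hsep (2 * i) (by omega)
      have h1 := hx (2 * i) (by omega)
      have h2 := hx (2 * i + 1) (by omega)
      have hsub : Icc (x (2 * i)) (x (2 * i + 1)) ⊆ Icc p q := Icc_subset_Icc h1.1 h2.2
      obtain ⟨y, hy, hslope⟩ := exists_hasDerivAt_eq_slope (G j) (G (j + 1))
        (show x (2 * i) < x (2 * i + 1) by linarith)
        (fun z hz => ((hG j (by omega) z (hsub hz)).continuousWithinAt.mono hsub))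
        (fun z hz => (hG j (by omega) z (hsub (Ioo_subset_Icc_self hz))).hasDerivAt
          (Icc_mem_nhds (h1.1.trans_lt hz.1) (hz.2.trans_le h2.2)))
      refine ⟨y, fun _ => ⟨hy, ?_⟩⟩
      rw [hslope, abs_div, abs_of_pos (show 0 < x (2 * i + 1) - x (2 * i) by linarith)]
      have e1 := hsmall (2 * i) (by omega)
      have e2 := hsmall (2 * i + 1) (by omega)
      have e3 := abs_sub (G j (x (2 * i + 1))) (G j (x (2 * i)))
      calc _ ≤ (2 * ((2 / d) ^ j * ε)) / d := by
            gcongr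
            · linarith [abs_nonneg (G j (x (2 * i)))]
            · linarith
            · linarith
        _ = _ := by ring
    choose y hy using key
    refine ⟨y, fun i hi => ?_, fun i hi => ?_, fun i hi => (hy i hi).2⟩
    · exact ⟨(hx (2 * i) (by omega)).1.trans (hy i hi).1.1.le,
        (hy i hi).1.2.le.trans (hx (2 * i + 1) (by omega)).2⟩
    · have h1 := (hy i (by omega)).1.2
      have h2 := (hy (i + 1) hi).1.1
      have h3 := hsep (2 * i + 1) (by omega)
      rw [show 2 * i + 1 + 1 = 2 * (i + 1) by ring] at h3
      linarith

/-- A function which is small on a set of proportion more than `δ` has each of its first `k`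
derivatives small somewhere. -/
theorem exists_deriv_small_of_volume
    (hG : ∀ j < k, ∀ x ∈ Icc p q, HasDerivWithinAt (G j) (G (j + 1) x) (Icc p q) x)
    (hpq : p < q) {δ ε : ℝ} (hδ : 0 < δ)
    (hvol : ENNReal.ofReal (δ * (q - p)) < volume {x ∈ Icc p q | |G 0 x| < ε})
    {j : ℕ} (hj : j ≤ k) :
    ∃ y ∈ Icc p q, |G j y| ≤ (2 ^ (k + 2) / (δ * (q - p))) ^ j * ε := by
  have hL : 0 < q - p := sub_pos.mpr hpq
  set d := δ * (q - p) / (2 * 2 ^ k) with hd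
  have hd0 : 0 < d := by positivity
  obtain ⟨x, hx, hsep⟩ := exists_separated_points hd0 (2 ^ k - 1)
    {x ∈ Icc p q | |G 0 x| < ε} ⟨p, fun z hz => hz.1.1⟩ (by
      refine lt_of_le_of_lt (ENNReal.ofReal_le_ofReal ?_) hvol
      rw [Nat.cast_sub Nat.one_le_two_pow]
      push_cast
      calc ((2 : ℝ) ^ k - 1) * (2 * d) ≤ 2 ^ k * (2 * d) := by gcongr; linarith
        _ = δ * (q - p) := by rw [hd]; field_simp)
  obtain ⟨y, hy, h⟩ := exists_deriv_small hG hd0 (fun i hi => (hx i (by omega)).1)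
    (fun i hi => hsep i (by omega)) (fun i hi => (hx i (by omega)).2.le) hj
  refine ⟨y, hy, h.trans_eq ?_⟩
  congr 2
  rw [hd]
  field_simp
  ring

/-- Small values of the first derivatives at some points, together with a top derivative of
bounded ratio, force the function to be small everywhere. -/
theorem abs_le_of_deriv_small
    (hG : ∀ j < k, ∀ x ∈ Icc p q, HasDerivWithinAt (G j) (G (j + 1) x) (Icc p q) x)
    {M τ ε : ℝ} (hM : 0 ≤ M) (hτ : 0 ≤ τ) (hε : 0 ≤ ε) (hτL : 1 ≤ τ * (q - p))
    (hratio : ∀ x ∈ Icc p q, ∀ y ∈ Icc p q, |G k x| ≤ M * |G k y|)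
    (hsmall : ∀ j ≤ k, ∃ y ∈ Icc p q, |G j y| ≤ τ ^ j * ε) :
    ∀ x ∈ Icc p q, |G 0 x| ≤ (M + k) * (τ * (q - p)) ^ k * ε := by
  suffices H : ∀ i ≤ k, ∀ x ∈ Icc p q,
      |G (k - i) x| ≤ (M + i) * (τ * (q - p)) ^ i * (τ ^ (k - i) * ε) by
    intro x hx
    simpa using H k le_rfl x hx
  intro i
  induction i with
  | zero =>
    intro _ x hx
    obtain ⟨y, hy, h⟩ := hsmall k le_rfl
    simpa using (hratio x hx y hy).trans (mul_le_mul_of_nonneg_left h hM)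
  | succ i ih =>
    intro hi x hx
    obtain ⟨y, hy, h⟩ := hsmall (k - (i + 1)) (by omega)
    have hj : k - i = k - (i + 1) + 1 := by omega
    have ih' := ih (by omega)
    rw [hj] at ih'
    set j := k - (i + 1)
    have hlip := (convex_Icc p q).norm_image_sub_le_of_norm_hasDerivWithin_le
      (fun z hz => hG j (by omega) z hz) (fun z hz => ih' z hz) hy hx
    have hxy : |x - y| ≤ q - p := abs_le.mpr ⟨by linarith [hx.1, hy.2], by linarith [hx.2, hy.1]⟩
    rw [Real.norm_eq_abs, Real.norm_eq_abs] at hlip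
    have h1 : |G j x| ≤ |G j y| + |G j x - G j y| := by
      have := abs_add_le (G j y) (G j x - G j y)
      simpa using this
    have h2 : (1 : ℝ) ≤ (τ * (q - p)) ^ (i + 1) := one_le_pow₀ hτL
    have hL : 0 ≤ q - p := (abs_nonneg _).trans hxy
    calc |G j x| ≤ τ ^ j * ε +
          (M + i) * (τ * (q - p)) ^ i * (τ ^ (j + 1) * ε) * (q - p) := by
          refine h1.trans (add_le_add h (hlip.trans ?_))
          gcongr
      _ ≤ (τ * (q - p)) ^ (i + 1) * (τ ^ j * ε) +
          (M + i) * (τ * (q - p)) ^ i * (τ ^ (j + 1) * ε) * (q - p) := by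
          exact add_le_add (le_mul_of_one_le_left (by positivity) h2) le_rfl
      _ = _ := by push_cast; ring

end DerivativeChain

/-- Sublevel sets of functions with a derivative of bounded ratio have small proportion. -/
theorem exists_volume_sublevel_le (n : ℕ) {M δ : ℝ} (hM : 0 ≤ M) (hδ : 0 < δ) (hδ1 : δ ≤ 1) :
    ∃ ε > 0, ∀ k ≤ n, ∀ (G : ℕ → ℝ → ℝ) (p q : ℝ), p < q →
      (∀ j < k, ∀ x ∈ Icc p q, HasDerivWithinAt (G j) (G (j + 1) x) (Icc p q) x) →
      (∀ x ∈ Icc p q, ∀ y ∈ Icc p q, |G k x| ≤ M * |G k y|) →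
      (∃ x ∈ Icc p q, 1 ≤ |G 0 x|) →
      volume {x ∈ Icc p q | |G 0 x| < ε} ≤ ENNReal.ofReal (δ * (q - p)) := by
  set A : ℝ := (M + n) * (2 ^ (n + 2) / δ) ^ n with hA
  have hbase : 1 ≤ 2 ^ (n + 2) / δ := by
    rw [le_div_iff₀ hδ, one_mul]
    exact hδ1.trans (one_le_pow₀ one_le_two)
  have hA0 : 0 ≤ A := by positivity
  refine ⟨1 / (A + 1), by positivity, fun k hk G p q hpq hG hratio ⟨x₀, hx₀, h1⟩ => ?_⟩
  have hL : 0 < q - p := sub_pos.mpr hpq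
  by_contra! hcon
  have hkbase : 1 ≤ 2 ^ (k + 2) / δ := by
    rw [le_div_iff₀ hδ, one_mul]
    exact hδ1.trans (one_le_pow₀ one_le_two)
  have hτ : 2 ^ (k + 2) / (δ * (q - p)) * (q - p) = 2 ^ (k + 2) / δ := by field_simp
  have hle := abs_le_of_deriv_small (k := k) (τ := 2 ^ (k + 2) / (δ * (q - p))) hG hM
    (by positivity) (show 0 ≤ 1 / (A + 1) by positivity) (by rwa [hτ]) hratio
    (fun j hj => exists_deriv_small_of_volume hG hpq hδ hcon hj) x₀ hx₀
  rw [hτ] at hle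
  have hkA : (M + k) * (2 ^ (k + 2) / δ) ^ k ≤ A := by
    rw [hA]
    have h2 : (2 : ℝ) ^ (k + 2) / δ ≤ 2 ^ (n + 2) / δ := by
      gcongr
      exact one_le_two
    have h3 : ((2 : ℝ) ^ (k + 2) / δ) ^ k ≤ (2 ^ (n + 2) / δ) ^ n :=
      (pow_le_pow_left₀ (by positivity) h2 k).trans (pow_le_pow_right₀ hbase hk)
    gcongr
  have : |G 0 x₀| ≤ A * (1 / (A + 1)) := hle.trans (by gcongr)
  have h4 : A * (1 / (A + 1)) < 1 := by
    rw [mul_one_div, div_lt_one (by positivity)]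
    linarith
  linarith

section Curve

variable {n : ℕ} {a b : ℝ}

/-- The iterated derivatives on `[a, b]` of the function `c₀ + ∑ i, c i * f i`. -/
noncomputable def comboDeriv (a b : ℝ) (f : Fin n → ℝ → ℝ) (c₀ : ℝ) (c : Fin n → ℝ) (j : ℕ)
    (x : ℝ) : ℝ :=
  (if j = 0 then c₀ else 0) + ∑ i, c i * iteratedDerivWithin j (f i) (Icc a b) x

theorem comboDeriv_zero (f : Fin n → ℝ → ℝ) (c₀ : ℝ) (c : Fin n → ℝ) (x : ℝ) :
    comboDeriv a b f c₀ c 0 x = c₀ + ∑ i, c i * f i x := by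
  simp [comboDeriv]

theorem hasDerivWithinAt_comboDeriv (hab : a < b) {f : Fin n → ℝ → ℝ}
    (hf : ∀ i, ContDiffOn ℝ n (f i) (Icc a b)) (c₀ : ℝ) (c : Fin n → ℝ) {j : ℕ} (hj : j < n)
    {x : ℝ} (hx : x ∈ Icc a b) :
    HasDerivWithinAt (comboDeriv a b f c₀ c j) (comboDeriv a b f c₀ c (j + 1) x) (Icc a b) x := by
  unfold comboDeriv
  simp only [Nat.add_eq_zero_iff, one_ne_zero, and_false, if_false, zero_add]
  refine HasDerivWithinAt.const_add _ (HasDerivWithinAt.fun_sum fun i _ => ?_)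
  refine HasDerivWithinAt.const_mul _ ?_
  rw [iteratedDerivWithin_succ]
  exact (((hf i).differentiableOn_iteratedDerivWithin (by exact_mod_cast hj)
    (uniqueDiffOn_Icc hab)) x hx).hasDerivWithinAt

theorem exists_wronskian_bound {f : Fin n → ℝ → ℝ} (hab : a < b)
    (hf : ∀ i, ContDiffOn ℝ n (f i) (Icc a b))
    (hW : ∀ x ∈ Icc a b,
      (Matrix.of fun i j : Fin n =>
        iteratedDerivWithin ((j : ℕ) + 1) (f i) (Icc a b) x).det ≠ 0) :
    ∃ κ > 0, ∀ x ∈ Icc a b, ∀ c : Fin n → ℝ, c ≠ 0 →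
      ∃ j : Fin n, κ * ‖c‖ ≤ |comboDeriv a b f 0 c (j + 1) x| := by
  set W : ℝ → Matrix (Fin n) (Fin n) ℝ := fun x => Matrix.of fun i j : Fin n =>
    iteratedDerivWithin ((j : ℕ) + 1) (f i) (Icc a b) x with hWdef
  have hcont : ContinuousOn W (Icc a b) := by
    refine continuousOn_pi.mpr fun i => continuousOn_pi.mpr fun j => ?_
    exact (hf i).continuousOn_iteratedDerivWithin (by exact_mod_cast j.2) (uniqueDiffOn_Icc hab)
  have hinv : ContinuousOn (fun x => (W x)⁻¹) (Icc a b) := by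
    have h1 : ContinuousOn (fun x => (W x).det) (Icc a b) :=
      (continuous_id.matrix_det).comp_continuousOn hcont
    have h2 : ContinuousOn (fun x => (W x).adjugate) (Icc a b) :=
      (continuous_id.matrix_adjugate).comp_continuousOn hcont
    refine ((h1.inv₀ hW).smul h2).congr fun x hx => ?_
    simp [Matrix.inv_def, Ring.inverse_eq_inv]
  have hbdd : ∀ i j, ∃ C, ∀ x ∈ Icc a b, |(W x)⁻¹ i j| ≤ C := fun i j =>
    isCompact_Icc.exists_bound_of_continuousOn (f := fun x => (W x)⁻¹ i j)
      (continuousOn_pi.mp (continuousOn_pi.mp hinv i) j)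
  choose C hC using hbdd
  set K : ℝ := ∑ i, ∑ j, |C i j| with hK
  have hK0 : 0 ≤ K := by positivity
  refine ⟨1 / (n * K + 1), by positivity, fun x hx c hc => ?_⟩
  by_contra! hcon
  have hcpos : 0 < ‖c‖ := norm_pos_iff.mpr hc
  set e : Fin n → ℝ := Matrix.vecMul c (W x) with he
  have hej : ∀ j, e j = comboDeriv a b f 0 c (j + 1) x := by
    intro j
    simp [he, Matrix.vecMul, dotProduct, comboDeriv, hWdef]
  have hback : c = Matrix.vecMul e (W x)⁻¹ := by
    rw [he, Matrix.vecMul_vecMul, Matrix.mul_nonsing_inv _ (isUnit_iff_ne_zero.mpr (hW x hx)),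
      Matrix.vecMul_one]
  have hle : ‖c‖ ≤ n * K * (1 / (n * K + 1) * ‖c‖) := by
    refine (pi_norm_le_iff_of_nonneg (by positivity)).mpr fun j => ?_
    conv_lhs => rw [hback]
    simp only [Matrix.vecMul, dotProduct]
    calc ‖∑ i, e i * (W x)⁻¹ i j‖ ≤ ∑ _i : Fin n, 1 / (n * K + 1) * ‖c‖ * K := by
          refine norm_sum_le_of_le _ fun i _ => ?_
          rw [norm_mul]
          have h1 : |(W x)⁻¹ i j| ≤ K :=
            (hC i j x hx).trans ((le_abs_self _).trans
              ((Finset.single_le_sum (f := fun j => |C i j|) (fun _ _ => abs_nonneg _)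
                (Finset.mem_univ j)).trans
              (Finset.single_le_sum (f := fun i => ∑ j, |C i j|)
                (fun _ _ => by positivity) (Finset.mem_univ i))))
          have h2 : ‖e i‖ ≤ 1 / (n * K + 1) * ‖c‖ := by
            rw [hej]
            exact (hcon i).le
          exact mul_le_mul h2 h1 (norm_nonneg _) (by positivity)
      _ = n * K * (1 / (n * K + 1) * ‖c‖) := by
          simp
          ring
  have : n * K * (1 / (n * K + 1) * ‖c‖) < ‖c‖ := by
    rw [show n * K * (1 / (n * K + 1) * ‖c‖) = (n * K / (n * K + 1)) * ‖c‖ by ring]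
    refine mul_lt_of_lt_one_left hcpos ?_
    rw [div_lt_one (by positivity)]
    linarith
  linarith

/-- On every short interval, each nontrivial combination of the `f i` has some derivative which is
bounded below in terms of the coefficients and whose values have bounded ratios. -/
def UniformDerivative (a b : ℝ) (f : Fin n → ℝ → ℝ) (r₀ κ M : ℝ) : Prop :=
  ∀ (c₀ : ℝ) (c : Fin n → ℝ) (p q : ℝ), a ≤ p → p < q → q ≤ b →
    q - p ≤ r₀ → c ≠ 0 → ∃ k, 1 ≤ k ∧ k ≤ n ∧
      (∀ x ∈ Icc p q, κ * ‖c‖ ≤ |comboDeriv a b f c₀ c k x|) ∧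
      ∀ x ∈ Icc p q, ∀ y ∈ Icc p q,
        |comboDeriv a b f c₀ c k x| ≤ M * |comboDeriv a b f c₀ c k y|

theorem exists_uniform_derivative {f : Fin n → ℝ → ℝ} (hab : a < b)
    (hf : ∀ i, ContDiffOn ℝ n (f i) (Icc a b))
    (hW : ∀ x ∈ Icc a b,
      (Matrix.of fun i j : Fin n =>
        iteratedDerivWithin ((j : ℕ) + 1) (f i) (Icc a b) x).det ≠ 0) :
    ∃ r₀ > 0, ∃ κ > 0, ∃ M ≥ 0, UniformDerivative a b f r₀ κ M := by
  obtain ⟨κ, hκ, hlow⟩ := exists_wronskian_bound hab hf hW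
  have hD : ∀ i (j : Fin n),
      ContinuousOn (iteratedDerivWithin ((j : ℕ) + 1) (f i) (Icc a b)) (Icc a b) := fun i j =>
    (hf i).continuousOn_iteratedDerivWithin (by exact_mod_cast j.2) (uniqueDiffOn_Icc hab)
  have hbdd : ∀ i (j : Fin n), ∃ C, ∀ x ∈ Icc a b,
      |iteratedDerivWithin ((j : ℕ) + 1) (f i) (Icc a b) x| ≤ C := fun i j =>
    isCompact_Icc.exists_bound_of_continuousOn (hD i j)
  choose C hC using hbdd
  set K : ℝ := ∑ i, ∑ j, |C i j| with hK
  have hK0 : 0 ≤ K := by positivity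
  set η : ℝ := κ / (2 * (n + 1)) with hη
  have hη0 : 0 < η := by positivity
  have huc : ∀ i (j : Fin n), ∃ r > 0, ∀ x ∈ Icc a b, ∀ y ∈ Icc a b, |x - y| < r →
      |iteratedDerivWithin ((j : ℕ) + 1) (f i) (Icc a b) x -
        iteratedDerivWithin ((j : ℕ) + 1) (f i) (Icc a b) y| < η := by
    intro i j
    have := Metric.uniformContinuousOn_iff.mp
      (isCompact_Icc.uniformContinuousOn_of_continuous (hD i j)) η hη0
    simpa [Real.dist_eq] using this
  choose r hr hruc using huc
  obtain ⟨r₀, hr₀, hr₀le⟩ : ∃ r₀ > 0, ∀ i j, r₀ < r i j := by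
    have : ∀ᶠ s in nhdsWithin (0 : ℝ) (Ioi 0), ∀ i j, s < r i j := by
      simp only [eventually_all]
      exact fun i j => (eventually_lt_nhds (hr i j)).filter_mono nhdsWithin_le_nhds
    obtain ⟨s, h1, h2⟩ := (this.and self_mem_nhdsWithin).exists
    exact ⟨s, h2, h1⟩
  refine ⟨r₀, hr₀, κ / 2, by positivity, n * K / (κ / 2), by positivity,
    fun c₀ c p q hap hpq hqb hlen hc => ?_⟩
  have hsub : Icc p q ⊆ Icc a b := Icc_subset_Icc hap hqb
  obtain ⟨j, hj⟩ := hlow p (hsub (left_mem_Icc.mpr hpq.le)) c hc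
  have hcpos : 0 < ‖c‖ := norm_pos_iff.mpr hc
  have hval : ∀ x, comboDeriv a b f c₀ c (j + 1) x =
      ∑ i, c i * iteratedDerivWithin ((j : ℕ) + 1) (f i) (Icc a b) x := fun x => by
    simp [comboDeriv]
  have hval0 : comboDeriv a b f 0 c (j + 1) p = comboDeriv a b f c₀ c (j + 1) p := by
    simp [comboDeriv]
  rw [hval0] at hj
  have hupper : ∀ x ∈ Icc p q, |comboDeriv a b f c₀ c (j + 1) x| ≤ n * K * ‖c‖ := by
    intro x hx
    rw [hval, ← Real.norm_eq_abs]
    calc _ ≤ ∑ _i : Fin n, ‖c‖ * K := by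
          refine norm_sum_le_of_le _ fun i _ => ?_
          rw [norm_mul]
          refine mul_le_mul (norm_le_pi_norm c i) ?_ (norm_nonneg _) (by positivity)
          exact (hC i j x (hsub hx)).trans ((le_abs_self _).trans
              ((Finset.single_le_sum (f := fun j => |C i j|) (fun _ _ => abs_nonneg _)
                (Finset.mem_univ j)).trans
              (Finset.single_le_sum (f := fun i => ∑ j, |C i j|)
                (fun _ _ => by positivity) (Finset.mem_univ i))))
      _ = n * K * ‖c‖ := by
          simp
          ring
  have hlower : ∀ x ∈ Icc p q, κ / 2 * ‖c‖ ≤ |comboDeriv a b f c₀ c (j + 1) x| := by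
    intro x hx
    have hdiff : |comboDeriv a b f c₀ c (j + 1) p - comboDeriv a b f c₀ c (j + 1) x| ≤
        κ / 2 * ‖c‖ := by
      rw [hval, hval, ← Finset.sum_sub_distrib, ← Real.norm_eq_abs]
      calc _ ≤ ∑ _i : Fin n, ‖c‖ * η := by
            refine norm_sum_le_of_le _ fun i _ => ?_
            rw [← mul_sub, norm_mul]
            refine mul_le_mul (norm_le_pi_norm c i) ?_ (norm_nonneg _) (by positivity)
            refine (hruc i j p (hsub (left_mem_Icc.mpr hpq.le)) x (hsub hx) ?_).le
            have := hr₀le i j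
            rw [abs_lt]
            constructor <;> linarith [hx.1, hx.2]
        _ = n / (n + 1) * (κ / 2 * ‖c‖) := by
            simp [hη]
            field_simp
        _ ≤ κ / 2 * ‖c‖ := by
            refine mul_le_of_le_one_left (by positivity) ?_
            rw [div_le_one (by positivity)]
            linarith
    have := abs_sub_abs_le_abs_sub (comboDeriv a b f c₀ c (j + 1) p)
      (comboDeriv a b f c₀ c (j + 1) x)
    linarith
  refine ⟨j + 1, by omega, j.2, hlower, fun x hx y hy => (hupper x hx).trans ?_⟩
  calc n * K * ‖c‖ = n * K / (κ / 2) * (κ / 2 * ‖c‖) := by field_simp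
    _ ≤ _ := by
      gcongr
      exact hlower y hy

/-- Functions which are pointwise suprema of absolute values of real combinations
`c₀ + ∑ i, c i * f i`. -/
def IsComboSup (a b : ℝ) (f : Fin n → ℝ → ℝ) (φ : ℝ → ℝ) : Prop :=
  ∀ x₀ ∈ Icc a b, ∃ (c₀ : ℝ) (c : Fin n → ℝ), φ x₀ = |c₀ + ∑ i, c i * f i x₀| ∧
    ∀ x ∈ Icc a b, |c₀ + ∑ i, c i * f i x| ≤ φ x

theorem IsComboSup.exists_volume_le {f : Fin n → ℝ → ℝ} (hab : a < b)
    (hf : ∀ i, ContDiffOn ℝ n (f i) (Icc a b)) {r₀ κ M : ℝ} (hM : 0 ≤ M)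
    (hU : UniformDerivative a b f r₀ κ M) {δ : ℝ} (hδ : 0 < δ) (hδ1 : δ ≤ 1) :
    ∃ ε > 0, ∀ φ, IsComboSup a b f φ → ∀ z r, 0 < r → Metric.closedBall z r ⊆ Icc a b →
      2 * r ≤ r₀ → (∃ x ∈ Metric.closedBall z r, 1 ≤ φ x) →
      volume {x ∈ Metric.closedBall z r | φ x < ε} ≤ ENNReal.ofReal (δ * (2 * r)) := by
  obtain ⟨ε, hε, H⟩ := exists_volume_sublevel_le n hM hδ hδ1
  refine ⟨min ε 1, by positivity, fun φ hφ z r hr hsub hr₀ ⟨x₀, hx₀, h1⟩ => ?_⟩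
  obtain ⟨c₀, c, heq, hle⟩ := hφ x₀ (hsub hx₀)
  rw [Real.closedBall_eq_Icc] at *
  have hends := (Icc_subset_Icc_iff (show z - r ≤ z + r by linarith)).mp hsub
  have hmono : {x ∈ Icc (z - r) (z + r) | φ x < min ε 1} ⊆
      {x ∈ Icc (z - r) (z + r) | |comboDeriv a b f c₀ c 0 x| < min ε 1} := by
    rintro x ⟨hx, hlt⟩
    refine ⟨hx, ?_⟩
    rw [comboDeriv_zero]
    exact (hle x (hsub hx)).trans_lt hlt
  refine (measure_mono hmono).trans ?_
  by_cases hc : c = 0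
  · have : {x ∈ Icc (z - r) (z + r) | |comboDeriv a b f c₀ c 0 x| < min ε 1} = ∅ := by
      refine eq_empty_of_forall_notMem fun x hx => ?_
      have h2 := hx.2
      rw [comboDeriv_zero] at h2
      rw [heq] at h1
      simp only [hc, Pi.zero_apply, zero_mul, Finset.sum_const_zero, add_zero] at h1 h2
      exact absurd (h2.trans_le (min_le_right _ _)) (not_lt.mpr h1)
    rw [this]
    simp
  · obtain ⟨k, -, hk, -, hratio⟩ := hU c₀ c (z - r) (z + r) hends.1 (by linarith) hends.2
      (by linarith) hc
    refine (measure_mono ?_).trans ((H k hk (comboDeriv a b f c₀ c) (z - r) (z + r) (by linarith)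
      (fun j hj x hx => (hasDerivWithinAt_comboDeriv hab hf c₀ c (hj.trans_le hk)
        (hsub hx)).mono hsub) hratio ⟨x₀, hx₀, ?_⟩).trans_eq ?_)
    · exact fun x hx => ⟨hx.1, hx.2.trans_le (min_le_left _ _)⟩
    · rw [comboDeriv_zero, ← heq]
      exact h1
    · congr 1
      ring

/-- Nonzero integer combinations are not uniformly small on a fixed interval. -/
theorem exists_integer_combo_lower_bound {f : Fin n → ℝ → ℝ} (hab : a < b)
    (hf : ∀ i, ContDiffOn ℝ n (f i) (Icc a b)) {r₀ κ M : ℝ} (hκ : 0 < κ)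
    (hU : UniformDerivative a b f r₀ κ M) {p q : ℝ} (hap : a ≤ p) (hpq : p < q) (hqb : q ≤ b)
    (hlen : q - p ≤ r₀) :
    ∃ η > 0, ∀ (c₀ : ℤ) (c : Fin n → ℤ), ¬(c₀ = 0 ∧ c = 0) →
      ∃ x ∈ Icc p q, η ≤ |(c₀ : ℝ) + ∑ i, (c i : ℝ) * f i x| := by
  have hL : 0 < q - p := sub_pos.mpr hpq
  set B : ℝ := (2 ^ (n + 2) / (1 / 2 * (q - p)) + 1) ^ n with hB
  have hB0 : 0 < B := by positivity
  refine ⟨min 1 (κ / (2 * B)), by positivity, fun c₀ c hc => ?_⟩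
  by_contra! hcon
  by_cases hc' : c = 0
  · have h0 : c₀ ≠ 0 := fun h => hc ⟨h, hc'⟩
    have h1 := hcon p (left_mem_Icc.mpr hpq.le)
    have h2 : (1 : ℝ) ≤ |(c₀ : ℝ)| := by exact_mod_cast Int.one_le_abs h0
    simp only [hc', Pi.zero_apply, Int.cast_zero, zero_mul, Finset.sum_const_zero, add_zero] at h1
    exact absurd (h1.trans_le (min_le_left _ _)) (not_lt.mpr h2)
  · obtain ⟨i, hi⟩ := Function.ne_iff.mp hc'
    set c' : Fin n → ℝ := fun i => (c i : ℝ) with hc'def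
    have hnorm : 1 ≤ ‖c'‖ := by
      refine le_trans ?_ (norm_le_pi_norm c' i)
      rw [Real.norm_eq_abs]
      have : (1 : ℝ) ≤ |(c i : ℝ)| := by exact_mod_cast Int.one_le_abs hi
      exact this
    have hc'0 : c' ≠ 0 := norm_pos_iff.mp (by linarith)
    obtain ⟨k, -, hk, hlow, -⟩ := hU c₀ c' p q hap hpq hqb hlen hc'0
    have hsub : Icc p q ⊆ Icc a b := Icc_subset_Icc hap hqb
    obtain ⟨y, hy, hsmall⟩ := exists_deriv_small_of_volume (k := k)
      (G := comboDeriv a b f c₀ c') (p := p) (q := q) (δ := 1 / 2) (ε := min 1 (κ / (2 * B)))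
      (fun j hj x hx => (hasDerivWithinAt_comboDeriv hab hf c₀ c' (hj.trans_le hk)
        (hsub hx)).mono hsub) hpq (by norm_num) (by
        have : {x ∈ Icc p q | |comboDeriv a b f c₀ c' 0 x| < min 1 (κ / (2 * B))} = Icc p q := by
          refine Subset.antisymm (fun x hx => hx.1) fun x hx => ⟨hx, ?_⟩
          rw [comboDeriv_zero]
          exact hcon x hx
        rw [this, Real.volume_Icc]
        exact (ENNReal.ofReal_lt_ofReal_iff hL).mpr (by linarith)) le_rfl
    have hpow : (2 ^ (k + 2) / (1 / 2 * (q - p))) ^ k ≤ B := by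
      have h1 : (2 : ℝ) ^ (k + 2) / (1 / 2 * (q - p)) ≤
          2 ^ (n + 2) / (1 / 2 * (q - p)) + 1 := by
        have : (2 : ℝ) ^ (k + 2) / (1 / 2 * (q - p)) ≤ 2 ^ (n + 2) / (1 / 2 * (q - p)) := by
          gcongr
          exact one_le_two
        linarith
      refine (pow_le_pow_left₀ (by positivity) h1 k).trans (pow_le_pow_right₀ ?_ hk)
      have : 0 ≤ (2 : ℝ) ^ (n + 2) / (1 / 2 * (q - p)) := by positivity
      linarith
    have h1 : |comboDeriv a b f c₀ c' k y| ≤ B * (κ / (2 * B)) :=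
      hsmall.trans (mul_le_mul hpow (min_le_right _ _) (by positivity) hB0.le)
    have h2 : B * (κ / (2 * B)) = κ / 2 := by field_simp
    have h3 : κ * 1 ≤ κ * ‖c'‖ := by gcongr
    have h4 := hlow y hy
    linarith

end Curve

section Nondivergence

variable {P : Type*} [PartialOrder P]

/-- A point is marked by a chain in `S` along which `ψ` is at most `1`, such that `ψ` is at least
`ε` at every element of `S` comparable to the chain. -/
def IsMarked (S : Set P) (ψ : P → ℝ → ℝ) (ε x : ℝ) : Prop :=
  ∃ T ⊆ S, IsChain (· ≤ ·) T ∧ (∀ s ∈ T, ψ s x ≤ 1) ∧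
    ∀ s ∈ S, (∀ t ∈ T, s ≤ t ∨ t ≤ s) → ε ≤ ψ s x

theorem IsMarked.mono {S : Set P} {ψ : P → ℝ → ℝ} {ε ε' x : ℝ} (h : IsMarked S ψ ε x)
    (hle : ε' ≤ ε) : IsMarked S ψ ε' x := by
  obtain ⟨T, hT, hchain, h1, h2⟩ := h
  exact ⟨T, hT, hchain, h1, fun s hs hc => hle.trans (h2 s hs hc)⟩

theorem IsMarked.of_comparable {S : Set P} {ψ : P → ℝ → ℝ} {ε x : ℝ} {s₀ : P} (hs₀ : s₀ ∈ S)
    (h : IsMarked {s ∈ S | s ≠ s₀ ∧ (s ≤ s₀ ∨ s₀ ≤ s)} ψ ε x) (h1 : ψ s₀ x ≤ 1)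
    (hε : ε ≤ ψ s₀ x) : IsMarked S ψ ε x := by
  obtain ⟨T, hT, hchain, hT1, hT2⟩ := h
  refine ⟨insert s₀ T, insert_subset hs₀ fun t ht => (hT ht).1,
    hchain.insert fun t ht _ => (hT ht).2.2.symm, ?_, ?_⟩
  · rintro s (rfl | hs)
    · exact h1
    · exact hT1 s hs
  · intro s hs hcomp
    by_cases h : s = s₀
    · rwa [h]
    · exact hT2 s ⟨hs, h, hcomp s₀ (mem_insert _ _)⟩ fun t ht =>
        hcomp t (mem_insert_of_mem _ ht)

/-- A covering estimate: if each point of a subset `E` of a ball is the center of a smaller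
ball in which `E` has proportion at most `δ`, then `E` has small measure. -/
theorem exists_covering_constant :
    ∃ N : ℕ, 0 < N ∧ ∀ (E : Set ℝ) (c ρ δ : ℝ), 0 < ρ → 0 ≤ δ → E ⊆ Metric.closedBall c ρ →
      (∀ z ∈ E, ∃ r, 0 < r ∧ r ≤ 2 * ρ ∧
        volume (E ∩ Metric.closedBall z r) ≤ ENNReal.ofReal (δ * (2 * r))) →
      volume E ≤ ENNReal.ofReal (N * δ * (2 * ρ)) := by
  obtain ⟨N, τ, hτ, hN⟩ := HasBesicovitchCovering.no_satelliteConfig (α := ℝ)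
  refine ⟨3 * (N + 1), by omega, fun E c ρ δ hρ hδ hE h => ?_⟩
  choose r hr0 hr2 hvol using h
  let q : Besicovitch.BallPackage E ℝ :=
    { c := fun z => z
      r := fun z => r z z.2
      rpos := fun z => hr0 z z.2
      r_bound := 2 * ρ
      r_le := fun z => hr2 z z.2 }
  obtain ⟨s, hdisj, hcov⟩ := Besicovitch.exist_disjoint_covering_families hτ hN q
  have hq : ∀ z : E, Metric.closedBall (q.c z) (q.r z) ⊆ Metric.closedBall c (3 * ρ) := by
    intro z
    refine Metric.closedBall_subset_closedBall' ?_
    have h1 : dist (q.c z) c ≤ ρ := hE z.2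
    have h2 : q.r z ≤ 2 * ρ := q.r_le z
    linarith
  have hcount : ∀ i, (s i).Countable := fun i =>
    (hdisj i).countable_of_nonempty_interior fun z _ => by
      rw [interior_closedBall _ (q.rpos z).ne']
      exact ⟨q.c z, Metric.mem_ball_self (q.rpos z)⟩
  have hfam : ∀ i, ∑' z : s i, volume (E ∩ Metric.closedBall (q.c z) (q.r z)) ≤
      ENNReal.ofReal δ * ENNReal.ofReal (6 * ρ) := by
    intro i
    calc ∑' z : s i, volume (E ∩ Metric.closedBall (q.c z) (q.r z))
        ≤ ∑' z : s i, ENNReal.ofReal δ * volume (Metric.closedBall (q.c z) (q.r z)) := by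
          refine ENNReal.tsum_le_tsum fun z => (hvol z.1 z.1.2).trans_eq ?_
          rw [Real.volume_closedBall, ← ENNReal.ofReal_mul hδ]
      _ = ENNReal.ofReal δ * ∑' z : s i, volume (Metric.closedBall (q.c z) (q.r z)) :=
          ENNReal.tsum_mul_left
      _ = ENNReal.ofReal δ * volume (⋃ z ∈ s i, Metric.closedBall (q.c z) (q.r z)) := by
          rw [measure_biUnion (hcount i) (hdisj i) fun z _ => measurableSet_closedBall]
      _ ≤ ENNReal.ofReal δ * volume (Metric.closedBall c (3 * ρ)) := by
          gcongr
          exact iUnion₂_subset fun z _ => hq z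
      _ = _ := by
          rw [Real.volume_closedBall]
          congr 2
          ring
  have hsub : E ⊆ ⋃ i, ⋃ z ∈ s i, E ∩ Metric.closedBall (q.c z) (q.r z) := by
    intro z hz
    obtain ⟨i, hi⟩ := mem_iUnion.mp (hcov ⟨⟨z, hz⟩, rfl⟩)
    obtain ⟨w, hw, hzw⟩ := mem_iUnion₂.mp hi
    exact mem_iUnion.mpr ⟨i, mem_iUnion₂.mpr ⟨w, hw, hz, Metric.ball_subset_closedBall hzw⟩⟩
  calc volume E ≤ ∑ i, volume (⋃ z ∈ s i, E ∩ Metric.closedBall (q.c z) (q.r z)) :=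
        (measure_mono hsub).trans (measure_iUnion_fintype_le _ _)
    _ ≤ ∑ _i : Fin N, ENNReal.ofReal δ * ENNReal.ofReal (6 * ρ) :=
        Finset.sum_le_sum fun i _ => (measure_biUnion_le _ (hcount i) _).trans (hfam i)
    _ = ENNReal.ofReal (N * (δ * (6 * ρ))) := by
        rw [← ENNReal.ofReal_mul hδ, Finset.sum_const, Finset.card_univ, Fintype.card_fin,
          nsmul_eq_mul, ENNReal.ofReal_mul (by positivity : (0 : ℝ) ≤ N), ENNReal.ofReal_natCast]
    _ ≤ _ := by
        refine ENNReal.ofReal_le_ofReal ?_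
        push_cast
        have : 0 ≤ δ * ρ := by positivity
        nlinarith

/-- Quantitative nondivergence on an interval, for families indexed by a poset of bounded rank. -/
theorem exists_volume_unmarked_le {a b r₀ : ℝ} (𝒢 : Set (ℝ → ℝ))
    (hcont : ∀ φ ∈ 𝒢, ContinuousOn φ (Icc a b))
    (hgood : ∀ δ > 0, δ ≤ 1 → ∃ ε > 0, ∀ φ ∈ 𝒢, ∀ z r, 0 < r →
      Metric.closedBall z r ⊆ Icc a b → 2 * r ≤ r₀ → (∃ x ∈ Metric.closedBall z r, 1 ≤ φ x) →
      volume {x ∈ Metric.closedBall z r | φ x < ε} ≤ ENNReal.ofReal (δ * (2 * r)))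
    {rk : P → ℕ} (hrk : StrictMono rk) (m : ℕ) :
    ∀ δ > 0, δ ≤ 1 → ∃ ε > 0, ε ≤ 1 ∧ ∀ (R : Finset ℕ) (S : Set P) (ψ : P → ℝ → ℝ) (c ρ : ℝ),
      R.card = m → (∀ s ∈ S, rk s ∈ R) → (∀ s ∈ S, ψ s ∈ 𝒢) → 0 < ρ →
      Metric.closedBall c (6 ^ m * ρ) ⊆ Icc a b → 2 * (6 ^ m * ρ) ≤ r₀ →
      (∀ s ∈ S, ∃ x ∈ Metric.closedBall c ρ, 1 ≤ ψ s x) →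
      volume {x ∈ Metric.closedBall c ρ | ¬ IsMarked S ψ ε x} ≤
        ENNReal.ofReal (δ * (2 * ρ)) := by
  obtain ⟨N, hN, hcov⟩ := exists_covering_constant
  induction m with
  | zero =>
    refine fun δ _ _ => ⟨1, one_pos, le_rfl, fun R S ψ c ρ hR hS _ _ _ _ _ => ?_⟩
    have : {x ∈ Metric.closedBall c ρ | ¬ IsMarked S ψ 1 x} = ∅ := by
      refine eq_empty_of_forall_notMem fun x hx => hx.2 ⟨∅, empty_subset _, IsChain.empty, ?_, ?_⟩
      · simp
      · intro s hs
        have := hS s hs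
        rw [Finset.card_eq_zero.mp hR] at this
        simp at this
    rw [this]
    simp
  | succ m ih =>
    intro δ hδ hδ1
    have hN' : (1 : ℝ) ≤ N := by exact_mod_cast hN
    set δ₁ : ℝ := δ / (4 * N) with hδ₁
    have hδ₁0 : 0 < δ₁ := by positivity
    have hδ₁1 : δ₁ ≤ 1 := by
      rw [hδ₁, div_le_one (by positivity)]
      linarith
    obtain ⟨ε₁, hε₁, hε₁1, H1⟩ := ih δ₁ hδ₁0 hδ₁1
    obtain ⟨ε₂, hε₂, H2⟩ := hgood δ₁ hδ₁0 hδ₁1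
    refine ⟨min ε₁ ε₂, by positivity, (min_le_left _ _).trans hε₁1, ?_⟩
    intro R S ψ c ρ hR hSR hψ hρ hball hr₀ hsup
    set ε := min ε₁ ε₂ with hε
    have h6 : (1 : ℝ) ≤ 6 ^ m := one_le_pow₀ (by norm_num)
    have hpow : (6 : ℝ) ^ (m + 1) = 6 * 6 ^ m := by ring
    refine (hcov _ c ρ (4 * δ₁) hρ (by positivity) (fun x hx => hx.1) ?_).trans_eq ?_
    swap
    · congr 1
      rw [hδ₁]
      field_simp
    rintro z ⟨hz, hunm⟩
    set A : Set ℝ := {r | 0 < r ∧ ∃ s ∈ S, ∀ x ∈ Metric.closedBall z r, ψ s x < 1} with hA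
    have hAbdd : ∀ r ∈ A, r < 2 * ρ := by
      rintro r ⟨-, s, hs, hlt⟩
      obtain ⟨x, hx, h1⟩ := hsup s hs
      by_contra! hcon
      refine absurd (hlt x ?_) (not_lt.mpr h1)
      rw [Metric.mem_closedBall] at hx hz ⊢
      linarith [dist_triangle x c z, dist_comm z c]
    have hzball : Metric.closedBall z ρ ⊆ Icc a b := by
      refine (Metric.closedBall_subset_closedBall' ?_).trans hball
      rw [Metric.mem_closedBall] at hz
      rw [hpow]
      nlinarith
    have hAne : A.Nonempty := by
      have : ∃ s ∈ S, ψ s z < 1 := by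
        by_contra! hcon
        exact hunm ⟨∅, empty_subset _, IsChain.empty, by simp, fun s hs _ =>
          ((min_le_left _ _).trans hε₁1).trans (hcon s hs)⟩
      obtain ⟨s, hs, hlt⟩ := this
      have hnhds : Icc a b ∈ nhds z := mem_of_superset (Metric.closedBall_mem_nhds z hρ) hzball
      have hev : ∀ᶠ x in nhds z, ψ s x < 1 :=
        ((hcont _ (hψ s hs)).continuousAt hnhds).eventually_lt_const hlt
      obtain ⟨r, hr, hsub⟩ := Metric.nhds_basis_closedBall.mem_iff.mp hev
      exact ⟨r, hr, s, hs, fun x hx => hsub hx⟩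
    have hAbdd' : BddAbove A := ⟨2 * ρ, fun r hr => (hAbdd r hr).le⟩
    obtain ⟨r₁, hr₁⟩ := hAne
    have hspos : 0 < sSup A := hr₁.1.trans_le (le_csSup hAbdd' hr₁)
    obtain ⟨r, hr, hrlt⟩ := exists_lt_of_lt_csSup ⟨r₁, hr₁⟩ (show sSup A / 2 < sSup A by linarith)
    have hr2 : r < 2 * ρ := hAbdd r hr
    obtain ⟨hr0, s₀, hs₀, hs₀lt⟩ := hr
    have hbig : ∀ s ∈ S, ∃ x ∈ Metric.closedBall z (2 * r), 1 ≤ ψ s x := by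
      intro s hs
      by_contra! hcon
      have := le_csSup hAbdd' (show 2 * r ∈ A from ⟨by positivity, s, hs, hcon⟩)
      linarith
    have hball2 : Metric.closedBall z (6 ^ m * (2 * r)) ⊆ Icc a b := by
      refine (Metric.closedBall_subset_closedBall' ?_).trans hball
      rw [Metric.mem_closedBall] at hz
      rw [hpow]
      nlinarith
    have hball3 : Metric.closedBall z (2 * r) ⊆ Icc a b :=
      (Metric.closedBall_subset_closedBall (by nlinarith)).trans hball2
    refine ⟨r, hr0, hr2.le, ?_⟩
    set S' : Set P := {s ∈ S | s ≠ s₀ ∧ (s ≤ s₀ ∨ s₀ ≤ s)} with hS'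
    have hIH := H1 (R.erase (rk s₀)) S' ψ z (2 * r)
      (by rw [Finset.card_erase_of_mem (hSR s₀ hs₀), hR]; rfl)
      (fun s hs => Finset.mem_erase.mpr ⟨by
        rcases hs.2.2 with h | h
        · exact (hrk (lt_of_le_of_ne h hs.2.1)).ne
        · exact (hrk (lt_of_le_of_ne h hs.2.1.symm)).ne', hSR s hs.1⟩)
      (fun s hs => hψ s hs.1) (by positivity) hball2 (by rw [hpow] at hr₀; nlinarith)
      (fun s hs => hbig s hs.1)
    have hg := H2 (ψ s₀) (hψ s₀ hs₀) z (2 * r) (by positivity) hball3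
      (by rw [hpow] at hr₀; nlinarith) (hbig s₀ hs₀)
    have hsub : {x ∈ Metric.closedBall c ρ | ¬ IsMarked S ψ ε x} ∩ Metric.closedBall z r ⊆
        {x ∈ Metric.closedBall z (2 * r) | ¬ IsMarked S' ψ ε₁ x} ∪
          {x ∈ Metric.closedBall z (2 * r) | ψ s₀ x < ε₂} := by
      rintro x ⟨⟨-, hx⟩, hxr⟩
      have hx2 : x ∈ Metric.closedBall z (2 * r) :=
        Metric.closedBall_subset_closedBall (by linarith) hxr
      by_cases h : ψ s₀ x < ε₂
      · exact Or.inr ⟨hx2, h⟩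
      · refine Or.inl ⟨hx2, fun hm => hx ?_⟩
        exact IsMarked.of_comparable hs₀ (hm.mono (min_le_left _ _)) (hs₀lt x hxr).le
          ((min_le_right _ _).trans (not_lt.mp h))
    refine (measure_mono hsub).trans ((measure_union_le _ _).trans ((add_le_add hIH hg).trans_eq ?_))
    rw [← ENNReal.ofReal_add (by positivity) (by positivity)]
    congr 1
    ring

end Nondivergence

section Minors

variable {k m : ℕ}

/-- All maximal minors of a `k`-tuple of vectors. -/
def minors (v : Fin k → Fin m → ℝ) (σ : Fin k → Fin m) : ℝ :=
  (Matrix.of fun i j => v i (σ j)).det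

theorem minors_eq_zero_of_not_injective (v : Fin k → Fin m → ℝ) {σ : Fin k → Fin m} {i j : Fin k}
    (hij : i ≠ j) (h : σ i = σ j) : minors v σ = 0 :=
  Matrix.det_zero_of_column_eq hij fun l => by simp [h]

theorem minors_of_eq_sum {v w : Fin k → Fin m → ℝ} (P : Matrix (Fin k) (Fin k) ℝ)
    (h : ∀ i, w i = ∑ j, P i j • v j) : minors w = P.det • minors v := by
  ext σ
  rw [Pi.smul_apply, smul_eq_mul, minors, minors, ← Matrix.det_mul]
  congr 1
  ext i j
  simp [h, Matrix.mul_apply, Finset.sum_apply]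

theorem exists_minors_ne_zero : ∀ {k : ℕ} {v : Fin k → Fin m → ℝ}, LinearIndependent ℝ v →
    ∃ σ, minors v σ ≠ 0 := by
  intro k
  induction k with
  | zero => exact fun _ => ⟨Fin.elim0, by simp [minors]⟩
  | succ k ih =>
    intro v hv
    obtain ⟨τ, hτ⟩ := ih (hv.comp Fin.succ (Fin.succ_injective k))
    by_contra! hcon
    set g : Fin (k + 1) → ℝ := fun i =>
      (-1) ^ (i : ℕ) * (Matrix.of fun i' j' => v (i.succAbove i') (τ j')).det with hg
    have hsum : ∑ i, g i • v i = 0 := by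
      ext j
      have h := hcon (Fin.cons j τ)
      rw [minors, Matrix.det_succ_column_zero] at h
      rw [Finset.sum_apply, Pi.zero_apply, ← h]
      refine Finset.sum_congr rfl fun i _ => ?_
      simp only [hg, Pi.smul_apply, smul_eq_mul, Matrix.of_apply, Fin.cons_zero]
      rw [show (Matrix.of fun i j_1 => v i (Fin.cons (α := fun _ => Fin m) j τ j_1)).submatrix
        i.succAbove Fin.succ = Matrix.of fun i' j' => v (i.succAbove i') (τ j') by
          ext; simp]
      ring
    have := Fintype.linearIndependent_iff.mp hv g hsum 0
    simp only [hg, Fin.val_zero, pow_zero, one_mul, Fin.succAbove_zero] at this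
    exact hτ this

theorem norm_minors_cons_le (u : Fin m → ℝ) (v : Fin k → Fin m → ℝ) :
    ‖minors (Fin.cons u v : Fin (k + 1) → Fin m → ℝ)‖ ≤ (k + 1) * (‖u‖ * ‖minors v‖) := by
  refine (pi_norm_le_iff_of_nonneg (by positivity)).mpr fun σ => ?_
  rw [minors, Matrix.det_succ_row_zero]
  calc _ ≤ ∑ _j : Fin (k + 1), ‖u‖ * ‖minors v‖ := by
        refine norm_sum_le_of_le _ fun j _ => ?_
        rw [norm_mul, norm_mul, norm_pow, norm_neg, norm_one, one_pow, one_mul]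
        refine mul_le_mul ?_ ?_ (norm_nonneg _) (norm_nonneg _)
        · exact norm_le_pi_norm u (σ j)
        · exact norm_le_pi_norm (minors v) fun i => σ (j.succAbove i)
    _ = _ := by simp

theorem exists_norm_minors_eq_nat (v : Fin k → Fin m → ℤ) (hm : 0 < m) :
    ∃ N : ℕ, ‖minors fun i j => (v i j : ℝ)‖ = N := by
  have : Nonempty (Fin m) := ⟨⟨0, hm⟩⟩
  obtain ⟨σ, hσ⟩ := Finite.exists_max fun σ => ‖minors (fun i j => (v i j : ℝ)) σ‖
  refine ⟨(Matrix.of fun i j => v i (σ j)).det.natAbs, ?_⟩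
  have h1 : ‖minors fun i j => (v i j : ℝ)‖ = ‖minors (fun i j => (v i j : ℝ)) σ‖ :=
    le_antisymm ((pi_norm_le_iff_of_nonneg (norm_nonneg _)).mpr hσ) (norm_le_pi_norm _ σ)
  rw [h1, Nat.cast_natAbs, Int.cast_abs, Real.norm_eq_abs, Int.cast_det]
  rfl

end Minors

section Covolume

variable {m : ℕ}

/-- The integer vectors `v` form a basis of the subspace `W`. -/
def IsIntegerBasis (W : Submodule ℝ (Fin m → ℝ)) {k : ℕ} (v : Fin k → Fin m → ℤ) : Prop :=
  LinearIndependent ℝ (fun i j => (v i j : ℝ)) ∧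
    Submodule.span ℝ (range fun i j => (v i j : ℝ)) = W

/-- A subspace is rational if it has a basis of integer vectors. -/
def rationalSubspaces (m : ℕ) : Set (Submodule ℝ (Fin m → ℝ)) :=
  {W | ∃ (k : ℕ) (v : Fin k → Fin m → ℤ), IsIntegerBasis W v}

/-- The covolume, up to comparability, of the image under `B` of the integer points of `W`. -/
noncomputable def covolume (W : Submodule ℝ (Fin m → ℝ)) (B : Matrix (Fin m) (Fin m) ℝ) : ℝ :=
  sInf {r | ∃ (k : ℕ) (v : Fin k → Fin m → ℤ), IsIntegerBasis W v ∧
    r = ‖minors fun i => Matrix.vecMul (fun j => (v i j : ℝ)) B‖}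

theorem covolume_le {W : Submodule ℝ (Fin m → ℝ)} {k : ℕ} {v : Fin k → Fin m → ℤ}
    (hv : IsIntegerBasis W v) (B : Matrix (Fin m) (Fin m) ℝ) :
    covolume W B ≤ ‖minors fun i => Matrix.vecMul (fun j => (v i j : ℝ)) B‖ := by
  refine csInf_le ⟨0, ?_⟩ ⟨k, v, hv, rfl⟩
  rintro r ⟨k, v, -, rfl⟩
  exact norm_nonneg _

theorem IsIntegerBasis.card_eq {W : Submodule ℝ (Fin m → ℝ)} {k : ℕ} {v : Fin k → Fin m → ℤ}
    (hv : IsIntegerBasis W v) : Module.finrank ℝ W = k := by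
  rw [← hv.2, finrank_span_eq_card hv.1, Fintype.card_fin]

/-- The covolume is attained at an integer basis not depending on the transformation. -/
theorem exists_covolume_eq (hm : 0 < m) {W : Submodule ℝ (Fin m → ℝ)}
    (hW : W ∈ rationalSubspaces m) :
    ∃ (k : ℕ) (v : Fin k → Fin m → ℤ), IsIntegerBasis W v ∧
      ∀ B, covolume W B = ‖minors fun i => Matrix.vecMul (fun j => (v i j : ℝ)) B‖ := by
  classical
  have hex : ∃ N : ℕ, ∃ (k : ℕ) (v : Fin k → Fin m → ℤ), IsIntegerBasis W v ∧
      ‖minors fun i j => (v i j : ℝ)‖ = N := by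
    obtain ⟨k, v, hv⟩ := hW
    obtain ⟨N, hN⟩ := exists_norm_minors_eq_nat v hm
    exact ⟨N, k, v, hv, hN⟩
  obtain ⟨k, v, hv, hvN⟩ := Nat.find_spec hex
  refine ⟨k, v, hv, fun B => le_antisymm (covolume_le hv B) ?_⟩
  refine le_csInf ⟨_, k, v, hv, rfl⟩ ?_
  rintro r ⟨k', w, hw, rfl⟩
  obtain rfl : k = k' := by rw [← hv.card_eq, hw.card_eq]
  have hmin : ‖minors fun i j => (v i j : ℝ)‖ ≤ ‖minors fun i j => (w i j : ℝ)‖ := by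
    obtain ⟨N, hN⟩ := exists_norm_minors_eq_nat w hm
    rw [hvN, hN]
    exact_mod_cast Nat.find_min' hex ⟨k, w, hw, hN⟩
  have hmem : ∀ i, ∃ c : Fin k → ℝ, ∑ j, c j • (fun l => (v j l : ℝ)) = fun l => (w i l : ℝ) := by
    intro i
    refine (Submodule.mem_span_range_iff_exists_fun ℝ).mp ?_
    rw [hv.2, ← hw.2]
    exact Submodule.subset_span ⟨i, rfl⟩
  choose P hP using hmem
  have h1 := minors_of_eq_sum (v := fun i j => (v i j : ℝ)) (w := fun i j => (w i j : ℝ))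
    (Matrix.of P) fun i => (hP i).symm
  have h2 := minors_of_eq_sum (v := fun i => Matrix.vecMul (fun j => (v i j : ℝ)) B)
    (w := fun i => Matrix.vecMul (fun j => (w i j : ℝ)) B) (Matrix.of P) fun i => by
      rw [← hP i, Matrix.sum_vecMul]
      simp [Matrix.smul_vecMul]
  have hpos : 0 < ‖minors fun i j => (v i j : ℝ)‖ := by
    obtain ⟨σ, hσ⟩ := exists_minors_ne_zero hv.1
    exact (norm_pos_iff.mpr hσ).trans_le (norm_le_pi_norm _ σ)
  rw [h1, norm_smul] at hmin
  have hdet : 1 ≤ ‖(Matrix.of P).det‖ := by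
    by_contra! hlt
    nlinarith
  rw [h2, norm_smul]
  exact le_mul_of_one_le_left (norm_nonneg _) hdet

theorem isIntegerBasis_bot (v : Fin 0 → Fin m → ℤ) :
    IsIntegerBasis (⊥ : Submodule ℝ (Fin m → ℝ)) v :=
  ⟨linearIndependent_empty_type, by simp⟩

theorem covolume_bot_le (B : Matrix (Fin m) (Fin m) ℝ) : covolume ⊥ B ≤ 1 := by
  refine (covolume_le (isIntegerBasis_bot Fin.elim0) B).trans ?_
  refine (pi_norm_le_iff_of_nonneg zero_le_one).mpr fun σ => ?_
  simp [minors]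

/-- At a marked point there are no short nonzero integer vectors. -/
theorem IsMarked.le_norm_vecMul (hm : 0 < m) {B : ℝ → Matrix (Fin m) (Fin m) ℝ} {ε x : ℝ}
    (h : IsMarked (rationalSubspaces m) (fun W x => covolume W (B x)) ε x)
    {u : Fin m → ℤ} (hu : u ≠ 0) :
    ε ≤ (m + 1) * ‖Matrix.vecMul (fun j => (u j : ℝ)) (B x)‖ := by
  obtain ⟨T, hT, hchain, hT1, hT2⟩ := h
  set u' : Fin m → ℝ := fun j => (u j : ℝ) with hu'
  have hu0 : u' ≠ 0 := fun h0 => hu (funext fun j => Int.cast_eq_zero.mp (congrFun h0 j : (u j : ℝ) = 0))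
  obtain ⟨Γ, ⟨hΓ, huΓ⟩, hmax⟩ := WellFounded.has_min
    (wellFounded_gt (α := Submodule ℝ (Fin m → ℝ)))
    {W | W ∈ insert ⊥ T ∧ u' ∉ W} ⟨⊥, mem_insert _ _, by simpa using hu0⟩
  have hΓS : Γ ∈ rationalSubspaces m := by
    rcases hΓ with rfl | hΓ
    · exact ⟨0, Fin.elim0, isIntegerBasis_bot _⟩
    · exact hT hΓ
  have hΓ1 : covolume Γ (B x) ≤ 1 := by
    rcases hΓ with rfl | hΓ
    · exact covolume_bot_le _
    · exact hT1 Γ hΓ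
  have hcomp : ∀ t ∈ T, Γ ≤ t ∨ t ≤ Γ := by
    intro t ht
    rcases hΓ with rfl | hΓ
    · exact Or.inl bot_le
    · exact hchain.total hΓ ht
  obtain ⟨k, v, hv, hcov⟩ := exists_covolume_eq hm hΓS
  have hcons : (fun i j => ((Fin.cons u v : Fin (k + 1) → Fin m → ℤ) i j : ℝ)) =
      Fin.cons u' fun i j => (v i j : ℝ) := by
    ext i j
    refine Fin.cases ?_ (fun i => ?_) i <;> simp [hu']
  have hbasis : IsIntegerBasis (Submodule.span ℝ {u'} ⊔ Γ)
      (Fin.cons u v : Fin (k + 1) → Fin m → ℤ) := by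
    rw [IsIntegerBasis, hcons]
    refine ⟨linearIndependent_finCons.mpr ⟨hv.1, by rwa [hv.2]⟩, ?_⟩
    rw [Fin.range_cons, Submodule.span_insert, hv.2]
  have hε := hT2 _ ⟨_, _, hbasis⟩ fun t ht => by
    by_cases hut : u' ∈ t
    · left
      refine sup_le ((Submodule.span_singleton_le_iff_mem _ _).mpr hut) ?_
      rcases hcomp t ht with h | h
      · exact h
      · exact absurd (h hut) huΓ
    · right
      refine le_sup_of_le_right ?_
      rcases hcomp t ht with h | h
      · by_contra hne
        exact hmax t ⟨mem_insert_of_mem _ ht, hut⟩ (lt_of_le_not_ge h hne)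
      · exact h
  have hk : (k : ℝ) ≤ m := by
    rw [← hv.card_eq]
    exact_mod_cast (Submodule.finrank_le Γ).trans_eq (by simp)
  refine hε.trans ((covolume_le hbasis (B x)).trans ?_)
  have hcons' : (fun i => Matrix.vecMul
      (fun j => ((Fin.cons u v : Fin (k + 1) → Fin m → ℤ) i j : ℝ)) (B x)) =
      Fin.cons (Matrix.vecMul u' (B x)) fun i => Matrix.vecMul (fun j => (v i j : ℝ)) (B x) := by
    ext i j
    refine Fin.cases ?_ (fun i => ?_) i <;> simp [hu']
  rw [hcons']
  refine (norm_minors_cons_le _ _).trans ?_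
  rw [← hcov]
  have h1 : ‖Matrix.vecMul u' (B x)‖ * covolume Γ (B x) ≤ ‖Matrix.vecMul u' (B x)‖ :=
    mul_le_of_le_one_right (norm_nonneg _) hΓ1
  have h2 := norm_nonneg (Matrix.vecMul u' (B x))
  calc _ ≤ ((k : ℝ) + 1) * ‖Matrix.vecMul u' (B x)‖ := by gcongr
    _ ≤ _ := by gcongr

end Covolume

section Lift

variable {n k : ℕ}

/-- The matrix carrying the integer vector `(c₀, c)` to `(Q ^ n * (c₀ + ∑ c l * y l), Q⁻¹ * c)`. -/
noncomputable def liftMatrix (Q : ℝ) (y : Fin n → ℝ) : Matrix (Fin (n + 1)) (Fin (n + 1)) ℝ :=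
  Matrix.of fun i j => Fin.cases (Q ^ n * (Fin.cons 1 y : Fin (n + 1) → ℝ) i)
    (fun l => if i = l.succ then Q⁻¹ else 0) j

theorem vecMul_liftMatrix_zero (Q : ℝ) (y : Fin n → ℝ) (v : Fin (n + 1) → ℝ) :
    Matrix.vecMul v (liftMatrix Q y) 0 = Q ^ n * (v 0 + ∑ l, v l.succ * y l) := by
  simp only [Matrix.vecMul, dotProduct, liftMatrix, Matrix.of_apply, Fin.cases_zero,
    Fin.sum_univ_succ, Fin.cons_zero, Fin.cons_succ, mul_add, Finset.mul_sum]
  congr 1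
  · ring
  · exact Finset.sum_congr rfl fun l _ => by ring

theorem vecMul_liftMatrix_succ (Q : ℝ) (y : Fin n → ℝ) (v : Fin (n + 1) → ℝ) (l : Fin n) :
    Matrix.vecMul v (liftMatrix Q y) l.succ = Q⁻¹ * v l.succ := by
  simp [Matrix.vecMul, dotProduct, liftMatrix, mul_comm]

theorem det_liftMatrix {Q : ℝ} (hQ : Q ≠ 0) (y : Fin n → ℝ) : (liftMatrix Q y).det = 1 := by
  rw [Matrix.det_of_isLowerTriangular, Fin.prod_univ_succ]
  · simp [liftMatrix, hQ]
  · intro i j hij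
    have hij' : i < j := hij
    obtain ⟨l, rfl⟩ := Fin.exists_succ_eq.mpr (Fin.ne_zero_of_lt hij')
    simp [liftMatrix, hij'.ne]

/-- Replacement of the first coordinate of `v` by `v 0 + ∑ v l.succ * y l`. -/
def twist (y : Fin n → ℝ) (v : Fin (n + 1) → ℝ) : Fin (n + 1) → ℝ :=
  Fin.cons (v 0 + ∑ l, v l.succ * y l) fun l => v l.succ

/-- The factors by which `liftMatrix Q y` scales the coordinates of the twisted vectors. -/
noncomputable def liftScale (n : ℕ) (Q : ℝ) : Fin (n + 1) → ℝ :=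
  Fin.cons (Q ^ n) fun _ => Q⁻¹

theorem minors_vecMul_liftMatrix (Q : ℝ) (y : Fin n → ℝ) (v : Fin k → Fin (n + 1) → ℝ)
    (σ : Fin k → Fin (n + 1)) :
    minors (fun i => Matrix.vecMul (v i) (liftMatrix Q y)) σ =
      (∏ j, liftScale n Q (σ j)) * minors (fun i => twist y (v i)) σ := by
  rw [minors, minors, ← Matrix.det_mul_row]
  congr 1
  ext i j
  simp only [Matrix.of_apply]
  refine Fin.cases ?_ (fun l => ?_) (σ j)
  · simp [vecMul_liftMatrix_zero, liftScale, twist]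
  · simp [vecMul_liftMatrix_succ, liftScale, twist]

theorem minors_twist_of_ne_zero (y : Fin n → ℝ) (v : Fin k → Fin (n + 1) → ℝ)
    {σ : Fin k → Fin (n + 1)} (hσ : ∀ j, σ j ≠ 0) :
    minors (fun i => twist y (v i)) σ = minors v σ := by
  unfold minors
  congr 1
  ext i j
  obtain ⟨l, hl⟩ := Fin.exists_succ_eq.mpr (hσ j)
  simp [← hl, twist]

theorem minors_twist (y : Fin n → ℝ) (v : Fin k → Fin (n + 1) → ℝ) {σ : Fin k → Fin (n + 1)}
    (hσ : Function.Injective σ) {j₀ : Fin k} (hj₀ : σ j₀ = 0) :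
    minors (fun i => twist y (v i)) σ =
      minors v σ + ∑ l : Fin n, minors v (Function.update σ j₀ l.succ) * y l := by
  set N : Matrix (Fin k) (Fin k) ℝ := Matrix.of fun i j => v i (σ j) with hN
  have hcol : ∀ l, minors v (Function.update σ j₀ l) = N.cramer (fun i => v i l) j₀ := by
    intro l
    rw [Matrix.cramer_apply, minors]
    congr 1
    ext i j
    by_cases h : j = j₀ <;> simp [h, hN]
  have h0 : minors v σ = N.cramer (fun i => v i 0) j₀ := by
    rw [← hcol, ← hj₀, Function.update_eq_self]
  have hw : (fun i => v i 0) + ∑ l : Fin n, y l • (fun i => v i l.succ) =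
      fun i => v i 0 + ∑ l, v i l.succ * y l := by
    ext i
    simp [Finset.sum_apply, mul_comm]
  have hL : minors (fun i => twist y (v i)) σ =
      N.cramer ((fun i => v i 0) + ∑ l : Fin n, y l • (fun i => v i l.succ)) j₀ := by
    rw [hw, Matrix.cramer_apply, minors]
    congr 1
    ext i j
    by_cases h : j = j₀
    · simp [h, hj₀, twist]
    · obtain ⟨l, hl⟩ := Fin.exists_succ_eq.mpr (fun h0 => h (hσ (h0.trans hj₀.symm)) : σ j ≠ 0)
      simp [h, hN, ← hl, twist]
  rw [hL, h0, map_add, map_sum, Pi.add_apply, Finset.sum_apply]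
  congr 1
  refine Finset.sum_congr rfl fun l _ => ?_
  rw [hcol, map_smul, Pi.smul_apply, smul_eq_mul, mul_comm]

theorem exists_minors_twist_eq (v : Fin k → Fin (n + 1) → ℝ) (σ : Fin k → Fin (n + 1)) :
    ∃ (c₀ : ℝ) (c : Fin n → ℝ), ∀ y, minors (fun i => twist y (v i)) σ = c₀ + ∑ l, c l * y l := by
  by_cases hσ : Function.Injective σ
  · by_cases h : ∃ j, σ j = 0
    · obtain ⟨j, hj⟩ := h
      exact ⟨_, _, fun y => minors_twist y v hσ hj⟩
    · push Not at h
      exact ⟨minors v σ, 0, fun y => by simp [minors_twist_of_ne_zero y v h]⟩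
  · obtain ⟨i, j, h, hij⟩ := Function.not_injective_iff.mp hσ
    exact ⟨0, 0, fun y => by simp [minors_eq_zero_of_not_injective _ hij h]⟩

theorem exists_minors_liftMatrix_eq (Q : ℝ) (v : Fin k → Fin (n + 1) → ℝ)
    (σ : Fin k → Fin (n + 1)) :
    ∃ (c₀ : ℝ) (c : Fin n → ℝ), ∀ y,
      minors (fun i => Matrix.vecMul (v i) (liftMatrix Q y)) σ = c₀ + ∑ l, c l * y l := by
  obtain ⟨c₀, c, h⟩ := exists_minors_twist_eq v σ
  refine ⟨(∏ j, liftScale n Q (σ j)) * c₀, fun l => (∏ j, liftScale n Q (σ j)) * c l, fun y => ?_⟩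
  rw [minors_vecMul_liftMatrix, h, mul_add, Finset.mul_sum]
  simp [mul_assoc]

theorem isComboSup_norm_minors {a b : ℝ} (f : Fin n → ℝ → ℝ) (Q : ℝ)
    (v : Fin k → Fin (n + 1) → ℝ) :
    IsComboSup a b f fun x =>
      ‖minors fun i => Matrix.vecMul (v i) (liftMatrix Q fun l => f l x)‖ := by
  intro x₀ _
  obtain ⟨σ, hσ⟩ := Finite.exists_max fun σ =>
    ‖minors (fun i => Matrix.vecMul (v i) (liftMatrix Q fun l => f l x₀)) σ‖
  obtain ⟨c₀, c, h⟩ := exists_minors_liftMatrix_eq Q v σ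
  refine ⟨c₀, c, ?_, fun x _ => ?_⟩
  · rw [← h, ← Real.norm_eq_abs]
    exact le_antisymm ((pi_norm_le_iff_of_nonneg (norm_nonneg _)).mpr hσ) (norm_le_pi_norm _ σ)
  · rw [← h, ← Real.norm_eq_abs]
    exact norm_le_pi_norm _ σ

theorem continuousOn_norm_minors {s : Set ℝ} {f : Fin n → ℝ → ℝ} (hf : ∀ i, ContinuousOn (f i) s)
    (Q : ℝ) (v : Fin k → Fin (n + 1) → ℝ) :
    ContinuousOn (fun x =>
      ‖minors fun i => Matrix.vecMul (v i) (liftMatrix Q fun l => f l x)‖) s := by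
  refine ContinuousOn.norm (continuousOn_pi.mpr fun σ => ?_)
  obtain ⟨c₀, c, h⟩ := exists_minors_liftMatrix_eq Q v σ
  simp only [h]
  exact continuousOn_const.add (continuousOn_finsetSum _ fun i _ => continuousOn_const.mul (hf i))

theorem prod_liftScale {Q : ℝ} {σ : Fin (k + 1) → Fin (n + 1)} (hσ : Function.Injective σ)
    {j₀ : Fin (k + 1)} (hj₀ : σ j₀ = 0) :
    ∏ j, liftScale n Q (σ j) = Q ^ n * Q⁻¹ ^ k := by
  rw [Fin.prod_univ_succAbove _ j₀, hj₀]
  congr 1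
  rw [Finset.prod_congr rfl (g := fun _ => Q⁻¹), Finset.prod_const, Finset.card_univ,
    Fintype.card_fin]
  intro j _
  obtain ⟨l, hl⟩ := Fin.exists_succ_eq.mpr
    (fun h => Fin.succAbove_ne j₀ j (hσ (h.trans hj₀.symm)) : σ (j₀.succAbove j) ≠ 0)
  simp [← hl, liftScale]

theorem exists_one_le_norm_minors {X : Set ℝ} {f : Fin n → ℝ → ℝ} {η Q : ℝ} (hX : X.Nonempty)
    (hη : ∀ (c₀ : ℤ) (c : Fin n → ℤ), ¬(c₀ = 0 ∧ c = 0) →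
      ∃ x ∈ X, η ≤ |(c₀ : ℝ) + ∑ i, (c i : ℝ) * f i x|)
    (hQ : 1 ≤ Q) (hηQ : 1 ≤ η * Q) (v : Fin k → Fin (n + 1) → ℤ)
    (hv : LinearIndependent ℝ fun i j => (v i j : ℝ)) :
    ∃ x ∈ X, 1 ≤ ‖minors fun i =>
      Matrix.vecMul (fun j => (v i j : ℝ)) (liftMatrix Q fun l => f l x)‖ := by
  have hQ0 : Q ≠ 0 := by positivity
  cases k with
  | zero =>
    obtain ⟨x, hx⟩ := hX
    refine ⟨x, hx, le_trans ?_ (norm_le_pi_norm _ Fin.elim0)⟩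
    simp [minors]
  | succ k =>
    obtain ⟨σ, hσ⟩ := exists_minors_ne_zero hv
    have hinj : Function.Injective σ := by
      intro i j h
      by_contra hij
      exact hσ (minors_eq_zero_of_not_injective _ hij h)
    set z : (Fin (k + 1) → Fin (n + 1)) → ℤ := fun τ => (Matrix.of fun i j => v i (τ j)).det
    have hz : ∀ τ, minors (fun i j => (v i j : ℝ)) τ = z τ := by
      intro τ
      rw [Int.cast_det]
      rfl
    obtain ⟨τ, j₀, hτ, hτ0, hne⟩ : ∃ (τ : Fin (k + 1) → Fin (n + 1)) (j₀ : Fin (k + 1)),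
        Function.Injective τ ∧ τ j₀ = 0 ∧
        ¬(z τ = 0 ∧ (fun l : Fin n => z (Function.update τ j₀ l.succ)) = 0) := by
      have hzσ : z σ ≠ 0 := fun h => hσ (by rw [hz, h, Int.cast_zero])
      by_cases h : ∃ j, σ j = 0
      · obtain ⟨j, hj⟩ := h
        exact ⟨σ, j, hinj, hj, fun h => hzσ h.1⟩
      · push Not at h
        refine ⟨Function.update σ 0 0, 0, ?_, Function.update_self _ _ _, fun h0 => ?_⟩
        · intro i j hij
          by_cases hi : i = 0 <;> by_cases hj : j = 0
          · rw [hi, hj]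
          · subst hi
            rw [Function.update_self, Function.update_of_ne hj] at hij
            exact absurd hij.symm (h j)
          · subst hj
            rw [Function.update_self, Function.update_of_ne hi] at hij
            exact absurd hij (h i)
          · rw [Function.update_of_ne hi, Function.update_of_ne hj] at hij
            exact hinj hij
        · obtain ⟨l, hl⟩ := Fin.exists_succ_eq.mpr (h 0)
          have := congrFun h0.2 l
          simp only [Function.update_idem, hl, Function.update_eq_self] at this
          exact hzσ this
    have hform : ∀ x, minors (fun i => Matrix.vecMul (fun j => (v i j : ℝ))
        (liftMatrix Q fun l => f l x)) τ = Q ^ n * Q⁻¹ ^ k *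
          (z τ + ∑ l : Fin n, (z (Function.update τ j₀ l.succ) : ℝ) * f l x) := by
      intro x
      rw [minors_vecMul_liftMatrix, prod_liftScale hτ hτ0, minors_twist _ _ hτ hτ0]
      simp only [hz]
    have hkn : k ≤ n := by
      have := Fintype.card_le_of_injective τ hτ
      simpa using this
    obtain ⟨x, hx, hle⟩ := hη _ _ hne
    refine ⟨x, hx, le_trans ?_ (norm_le_pi_norm _ τ)⟩
    rw [hform, norm_mul, Real.norm_eq_abs, Real.norm_eq_abs]
    have hpow : Q ^ n * Q⁻¹ ^ k = Q ^ (n - k) := by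
      rw [inv_pow, ← div_eq_mul_inv, pow_sub₀ _ hQ0 hkn, div_eq_mul_inv]
    rw [hpow, abs_of_nonneg (by positivity)]
    rcases hkn.lt_or_eq with hlt | rfl
    · have h1 : Q ≤ Q ^ (n - k) := le_self_pow₀ hQ (by omega)
      calc (1 : ℝ) ≤ Q * η := by linarith [mul_comm η Q]
        _ ≤ Q * |(z τ : ℝ) + ∑ l : Fin n, (z (Function.update τ j₀ l.succ) : ℝ) * f l x| := by
          gcongr
        _ ≤ _ := by gcongr
    · have hzero : ∀ l : Fin k, z (Function.update τ j₀ l.succ) = 0 := by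
        intro l
        obtain ⟨j, hj⟩ := (Finite.injective_iff_surjective.mp hτ) l.succ
        have hjj : j ≠ j₀ := by
          rintro rfl
          exact Fin.succ_ne_zero l (hj.symm.trans hτ0)
        have := minors_eq_zero_of_not_injective (fun i j => (v i j : ℝ))
          (σ := Function.update τ j₀ l.succ) hjj (by simp [hjj, hj])
        rw [hz] at this
        exact_mod_cast this
      have hzτ : z τ ≠ 0 := fun h => hne ⟨h, funext hzero⟩
      simp only [Nat.sub_self, pow_zero, one_mul, hzero, Int.cast_zero, zero_mul,
        Finset.sum_const_zero, add_zero]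
      exact_mod_cast Int.one_le_abs hzτ

end Lift

section Minkowski

variable {ι : Type*} [Fintype ι] [DecidableEq ι]

/-- Minkowski's linear forms theorem. -/
theorem exists_int_vecMul_lt {B : Matrix ι ι ℝ} (hB : B.det = 1) {r : ι → ℝ} (hr : ∀ i, 0 < r i)
    (hprod : 1 < ∏ i, r i) :
    ∃ u : ι → ℤ, u ≠ 0 ∧ ∀ i, |Matrix.vecMul (fun j => (u j : ℝ)) B i| < r i := by
  classical
  have hunit : IsUnit B := (Matrix.isUnit_iff_isUnit_det B).mpr (by simp [hB])
  have hli : LinearIndependent ℝ B.row := Matrix.linearIndependent_rows_iff_isUnit.mpr hunit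
  let b : Module.Basis ι ℝ (ι → ℝ) := basisOfPiSpaceOfLinearIndependent hli
  have hb : (b : ι → ι → ℝ) = B.row := coe_basisOfPiSpaceOfLinearIndependent hli
  set s : Set (ι → ℝ) := Set.pi univ fun i => Ioo (-r i) (r i) with hs
  have : Countable (Submodule.span ℤ (range b)).toAddSubgroup :=
    inferInstanceAs (Countable (Submodule.span ℤ (range b)))
  obtain ⟨z, hz0, hzs⟩ := exists_ne_zero_mem_lattice_of_measure_mul_two_pow_lt_measure
    (s := s) (ZSpan.isAddFundamentalDomain' b volume)
    (fun x hx i hi => by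
      have := hx i hi
      simp only [mem_Ioo, Pi.neg_apply] at this ⊢
      constructor <;> linarith)
    (convex_pi fun i _ => convex_Ioo _ _) (by
      rw [ZSpan.volume_fundamentalDomain, hs, volume_pi, Measure.pi_pi, hb]
      have hdet : (Matrix.of B.row).det = 1 := hB
      simp only [Real.volume_Ioo, hdet, abs_one, ENNReal.ofReal_one, one_mul,
        Module.finrank_fintype_fun_eq_card]
      rw [← ENNReal.ofReal_prod_of_nonneg fun i _ => by linarith [hr i]]
      rw [Finset.prod_congr rfl (g := fun i => 2 * r i) fun i _ => by ring, Finset.prod_mul_distrib,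
        Finset.prod_const, Finset.card_univ, ENNReal.ofReal_mul (by positivity)]
      rw [ENNReal.ofReal_pow (by norm_num), ENNReal.ofReal_ofNat]
      refine lt_of_eq_of_lt (mul_one _).symm
        ((ENNReal.mul_lt_mul_iff_right (by simp) (by simp)).mpr ?_)
      rwa [ENNReal.one_lt_ofReal])
  obtain ⟨u, hu⟩ := (Submodule.mem_span_range_iff_exists_fun ℤ).mp z.2
  have hval : Matrix.vecMul (fun j => (u j : ℝ)) B = z := by
    rw [← hu, hb]
    ext i
    simp [Matrix.vecMul, dotProduct, Finset.sum_apply]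
  refine ⟨u, ?_, fun i => ?_⟩
  · rintro rfl
    refine hz0 (Subtype.ext ?_)
    rw [← hval]
    ext i
    simp [Matrix.vecMul, dotProduct]
  · rw [hval, abs_lt]
    exact hzs i (mem_univ i)

/-- A unimodular lattice without short vectors has bounded covering radius. -/
theorem exists_covering_radius {ε : ℝ} (hε : 0 < ε) :
    ∃ C : ℝ, 0 < C ∧ ∀ A : Matrix ι ι ℝ, A.det = 1 →
      (∀ u : ι → ℤ, u ≠ 0 → ε ≤ ‖Matrix.vecMul (fun j => (u j : ℝ)) A‖) →
      ∀ p : ι → ℝ, ∃ u : ι → ℤ, ‖Matrix.vecMul (fun j => (u j : ℝ)) A - p‖ ≤ C := by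
  set N := Fintype.card ι
  obtain ⟨M, hM⟩ := exists_nat_gt (1 / ε ^ N)
  have hM1 : 1 < ε ^ N * (M + 1 : ℝ) := by
    rw [div_lt_iff₀ (by positivity)] at hM
    nlinarith [pow_pos hε N]
  have hf : (0 : ℝ) < M.factorial := by exact_mod_cast M.factorial_pos
  refine ⟨M.factorial * ε, by positivity, fun A hA hmin p => ?_⟩
  set B : Matrix (ι ⊕ Unit) (ι ⊕ Unit) ℝ :=
    Matrix.fromBlocks A 0 (Matrix.of fun _ i => p i / M.factorial) 1 with hB
  have hBdet : B.det = 1 := by rw [hB, Matrix.det_fromBlocks_zero₁₂, hA]; simp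
  obtain ⟨w, hw0, hw⟩ := exists_int_vecMul_lt hBdet
    (r := Sum.elim (fun _ => ε) fun _ => (M + 1 : ℝ))
    (by rintro (i | i) <;> simp <;> positivity) (by simpa [N] using hM1)
  set m : ℤ := w (Sum.inr ()) with hm
  set u : ι → ℤ := fun i => w (Sum.inl i) with hu
  have h1 : ∀ i, |Matrix.vecMul (fun j => (u j : ℝ)) A i + m * (p i / M.factorial)| < ε := by
    intro i
    have := hw (Sum.inl i)
    rw [hB, Matrix.vecMul_fromBlocks] at this
    simpa [Matrix.vecMul, dotProduct, Function.comp_def] using this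
  have h2 : |m| ≤ M := by
    have := hw (Sum.inr ())
    rw [hB, Matrix.vecMul_fromBlocks] at this
    have h : |(m : ℝ)| < M + 1 := by
      simpa [Matrix.vecMul, dotProduct, Function.comp_def] using this
    have h' : |m| < M + 1 := by exact_mod_cast h
    omega
  have hm0 : m ≠ 0 := by
    intro h0
    have hu0 : u ≠ 0 := by
      intro h
      refine hw0 (funext ?_)
      rintro (i | i)
      · exact congrFun h i
      · exact h0
    refine absurd (hmin u hu0) (not_le.mpr ((pi_norm_lt_iff hε).mpr fun i => ?_))
    simpa [h0] using h1 i
  obtain ⟨d, hd⟩ : m ∣ M.factorial := by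
    rw [← Int.natAbs_dvd_natAbs, Int.natAbs_natCast]
    rw [Int.abs_eq_natAbs] at h2
    exact Nat.dvd_factorial (Int.natAbs_pos.mpr hm0) (by omega)
  have hdR : (M.factorial : ℝ) = m * d := by exact_mod_cast hd
  have hmR : (1 : ℝ) ≤ |(m : ℝ)| := by exact_mod_cast Int.one_le_abs hm0
  have hdle : |(d : ℝ)| ≤ M.factorial := by
    rw [← abs_of_pos hf, hdR, abs_mul]
    exact le_mul_of_one_le_left (abs_nonneg _) hmR
  refine ⟨fun i => -(d * u i), (pi_norm_le_iff_of_nonneg (by positivity)).mpr fun i => ?_⟩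
  have hvec : Matrix.vecMul (fun j => ((-(d * u j) : ℤ) : ℝ)) A =
      (-d : ℝ) • Matrix.vecMul (fun j => (u j : ℝ)) A := by
    rw [← Matrix.smul_vecMul]
    congr 1
    ext j
    simp
  have hrew : Matrix.vecMul (fun j => ((-(d * u j) : ℤ) : ℝ)) A i - p i =
      -d * (Matrix.vecMul (fun j => (u j : ℝ)) A i + m * (p i / M.factorial)) := by
    rw [hvec, Pi.smul_apply, smul_eq_mul]
    field_simp
    rw [hdR]
    ring
  rw [Pi.sub_apply, hrew, Real.norm_eq_abs, abs_mul, abs_neg]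
  exact mul_le_mul hdle (h1 i).le (abs_nonneg _) hf.le

end Minkowski

section Zeros

theorem exists_zero_of_le_deriv {g g' : ℝ → ℝ} {a b x h m : ℝ} (hh : 0 ≤ h)
    (hsub : Icc (x - h) (x + h) ⊆ Icc a b)
    (hg : ∀ y ∈ Icc a b, HasDerivWithinAt g (g' y) (Icc a b) y)
    (hm : ∀ y ∈ Icc (x - h) (x + h), m ≤ g' y) (hx : |g x| ≤ m * h) :
    ∃ α ∈ Icc (x - h) (x + h), g α = 0 := by
  have hcont : ContinuousOn g (Icc (x - h) (x + h)) :=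
    fun y hy => ((hg y (hsub hy)).continuousWithinAt).mono hsub
  have hder : ∀ y ∈ interior (Icc (x - h) (x + h)), HasDerivAt g (g' y) y := fun y hy =>
    (hg y (hsub (interior_subset hy))).hasDerivAt
      (mem_of_superset (mem_interior_iff_mem_nhds.mp hy) hsub)
  have hmono := (convex_Icc (x - h) (x + h)).mul_sub_le_image_sub_of_le_deriv hcont
    (fun y hy => (hder y hy).differentiableAt.differentiableWithinAt) (C := m)
    (fun y hy => by rw [(hder y hy).deriv]; exact hm y (interior_subset hy))
  have h1 := hmono (x - h) ⟨le_rfl, by linarith⟩ x ⟨by linarith, by linarith⟩ (by linarith)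
  have h2 := hmono x ⟨by linarith, by linarith⟩ (x + h) ⟨by linarith, le_rfl⟩ (by linarith)
  rw [sub_sub_cancel] at h1
  rw [add_sub_cancel_left] at h2
  have hx' := abs_le.mp hx
  exact intermediate_value_Icc (by linarith) hcont ⟨by linarith, by linarith⟩

variable {n : ℕ} {a b : ℝ}

theorem exists_sum_abs_derivWithin_ge (hn : 1 ≤ n) (hab : a < b) {f : Fin n → ℝ → ℝ}
    (hf : ∀ i, ContDiffOn ℝ n (f i) (Icc a b))
    (hW : ∀ x ∈ Icc a b,
      (Matrix.of fun i j : Fin n =>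
        iteratedDerivWithin ((j : ℕ) + 1) (f i) (Icc a b) x).det ≠ 0) :
    ∃ κ > 0, ∀ x ∈ Icc a b, κ ≤ ∑ i, |derivWithin (f i) (Icc a b) x| := by
  have hcont : ContinuousOn (fun x => ∑ i, |derivWithin (f i) (Icc a b) x|) (Icc a b) :=
    continuousOn_finsetSum _ fun i _ =>
      ((hf i).continuousOn_derivWithin (uniqueDiffOn_Icc hab) (by exact_mod_cast hn)).abs
  obtain ⟨x₀, hx₀, hmin⟩ := isCompact_Icc.exists_isMinOn (nonempty_Icc.mpr hab.le) hcont
  refine ⟨_, ?_, fun x hx => hmin hx⟩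
  refine (Finset.sum_nonneg fun i _ => abs_nonneg _).lt_of_ne' fun h0 => hW x₀ hx₀ ?_
  refine Matrix.det_eq_zero_of_column_eq_zero ⟨0, hn⟩ fun i => ?_
  have := (Finset.sum_eq_zero_iff_of_nonneg fun i _ => abs_nonneg _).mp h0 i (Finset.mem_univ i)
  simpa [iteratedDerivWithin_one] using this

theorem exists_uniformContinuity {g : ℝ → ℝ} (hg : ContinuousOn g (Icc a b)) {ω : ℝ}
    (hω : 0 < ω) : ∃ r > 0, ∀ x ∈ Icc a b, ∀ y ∈ Icc a b, |y - x| ≤ r → |g y - g x| ≤ ω := by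
  obtain ⟨δ, hδ, h⟩ := Metric.uniformContinuousOn_iff.mp
    (isCompact_Icc.uniformContinuousOn_of_continuous hg) ω hω
  refine ⟨δ / 2, by positivity, fun x hx y hy hxy => ?_⟩
  exact (h y hy x hx (by rw [Real.dist_eq]; linarith)).le

/-- A point at which the lifted lattice has no short vectors is close to a zero of an integer
combination with controlled coefficients. -/
theorem exists_near_zero (hn : 1 ≤ n) (hab : a < b) {f : Fin n → ℝ → ℝ}
    (hf : ∀ i, ContDiffOn ℝ n (f i) (Icc a b))
    (hW : ∀ x ∈ Icc a b,
      (Matrix.of fun i j : Fin n =>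
        iteratedDerivWithin ((j : ℕ) + 1) (f i) (Icc a b) x).det ≠ 0)
    {lam : ℝ → ℝ} (hlam : ContDiffOn ℝ 2 lam (Icc a b)) {ε : ℝ} (hε : 0 < ε) :
    ∃ C > 0, ∃ r > 0, ∀ Q x h : ℝ, 1 ≤ Q → h = C / Q ^ (n + 1) → h ≤ r →
      Icc (x - h) (x + h) ⊆ Icc a b →
      (∀ w : Fin (n + 1) → ℤ, w ≠ 0 →
        ε ≤ ‖Matrix.vecMul (fun j => (w j : ℝ)) (liftMatrix Q fun l => f l x)‖) →
      ∃ α ∈ Icc (x - h) (x + h), ∃ (c₀ : ℤ) (c : Fin n → ℤ), ¬(c₀ = 0 ∧ c = 0) ∧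
        (c₀ : ℝ) + (∑ i, (c i : ℝ) * f i α) + lam α = 0 ∧ ∀ i, |(c i : ℝ)| ≤ C * Q := by
  obtain ⟨κ, hκ, hκle⟩ := exists_sum_abs_derivWithin_ge hn hab hf hW
  obtain ⟨C, hC, hcov⟩ := exists_covering_radius (ι := Fin (n + 1)) hε
  have hu := uniqueDiffOn_Icc hab
  have hfc : ∀ i, ContinuousOn (derivWithin (f i) (Icc a b)) (Icc a b) := fun i =>
    (hf i).continuousOn_derivWithin hu (by exact_mod_cast hn)
  have hlc : ContinuousOn (derivWithin lam (Icc a b)) (Icc a b) :=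
    hlam.continuousOn_derivWithin hu (by norm_num)
  obtain ⟨Λ, hΛ⟩ := isCompact_Icc.exists_bound_of_continuousOn hlc
  have hΛ0 : 0 ≤ Λ := (norm_nonneg _).trans (hΛ a ⟨le_rfl, hab.le⟩)
  set D : ℝ := (2 + Λ) / κ with hD
  have hD0 : 0 < D := by positivity
  set K : ℝ := 2 * C + D with hK
  have hK0 : 0 < K := by positivity
  set ω : ℝ := 1 / (n * K + 1) with hω
  have hω0 : 0 < ω := by positivity
  choose rf hrf hrfle using fun i => exists_uniformContinuity (hfc i) hω0
  obtain ⟨rl, hrl, hrlle⟩ := exists_uniformContinuity hlc hω0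
  obtain ⟨r, hr, hrle⟩ : ∃ r > 0, r ≤ rl ∧ ∀ i, r ≤ rf i := by
    have : Nonempty (Fin n) := ⟨⟨0, hn⟩⟩
    obtain ⟨i₀, hi₀⟩ := Finite.exists_min rf
    exact ⟨min rl (rf i₀), lt_min hrl (hrf i₀), min_le_left _ _,
      fun i => (min_le_right _ _).trans (hi₀ i)⟩
  refine ⟨K, hK0, r, hr, fun Q x h hQ hh hhr hsub hshort => ?_⟩
  have hQ0 : 0 < Q := one_pos.trans_le hQ
  have hh0 : 0 ≤ h := by rw [hh]; positivity
  have hxI : x ∈ Icc (x - h) (x + h) := ⟨by linarith, by linarith⟩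
  have hx := hsub hxI
  set s : Fin n → ℝ := fun l => (SignType.sign (derivWithin (f l) (Icc a b) x) : ℝ) with hs
  obtain ⟨w, hw⟩ := hcov _ (det_liftMatrix hQ0.ne' fun l => f l x) hshort
    (Fin.cons (-(Q ^ n * lam x)) fun l => (C + D) * s l)
  have hcoord := (pi_norm_le_iff_of_nonneg hC.le).mp hw
  set c : Fin n → ℤ := fun l => w l.succ with hc
  have h0 : Q ^ n * |(w 0 : ℝ) + (∑ l, (c l : ℝ) * f l x) + lam x| ≤ C := by
    have := hcoord 0
    rw [Pi.sub_apply, vecMul_liftMatrix_zero, Fin.cons_zero, sub_neg_eq_add, ← mul_add, norm_mul,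
      Real.norm_eq_abs, Real.norm_eq_abs, abs_of_pos (by positivity)] at this
    exact this
  have h1 : ∀ l, |Q⁻¹ * c l - (C + D) * s l| ≤ C := by
    intro l
    have := hcoord l.succ
    rwa [Pi.sub_apply, vecMul_liftMatrix_succ, Fin.cons_succ, Real.norm_eq_abs] at this
  have hs1 : ∀ l, |s l| ≤ 1 := by
    intro l
    rcases lt_trichotomy (derivWithin (f l) (Icc a b) x) 0 with h | h | h <;> simp [hs, h]
  have hcle : ∀ l, |(c l : ℝ)| ≤ K * Q := by
    intro l
    have h2 : |Q⁻¹ * c l| ≤ K := by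
      calc |Q⁻¹ * c l| = |(Q⁻¹ * c l - (C + D) * s l) + (C + D) * s l| := by ring_nf
        _ ≤ |Q⁻¹ * c l - (C + D) * s l| + |(C + D) * s l| := abs_add_le _ _
        _ ≤ C + (C + D) * 1 := by
          rw [abs_mul, abs_of_pos (by positivity : 0 < C + D)]
          gcongr
          · exact h1 l
          · exact hs1 l
        _ = K := by rw [hK]; ring
    rwa [abs_mul, abs_of_pos (inv_pos.mpr hQ0), inv_mul_le_iff₀ hQ0, mul_comm] at h2
  have hterm : ∀ l, Q * D * |derivWithin (f l) (Icc a b) x| ≤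
      c l * derivWithin (f l) (Icc a b) x := by
    intro l
    have h2 := abs_le.mp (h1 l)
    have h3 : (c l : ℝ) = Q * (Q⁻¹ * c l) := by field_simp
    rcases lt_trichotomy (derivWithin (f l) (Icc a b) x) 0 with h | h | h
    · have hsl : s l = -1 := by simp [hs, h]
      rw [hsl] at h2
      rw [abs_of_neg h, h3, mul_assoc, mul_assoc]
      refine mul_le_mul_of_nonneg_left ?_ hQ0.le
      nlinarith
    · simp [h]
    · have hsl : s l = 1 := by simp [hs, h]
      rw [hsl] at h2
      rw [abs_of_pos h, h3, mul_assoc, mul_assoc]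
      refine mul_le_mul_of_nonneg_left ?_ hQ0.le
      nlinarith
  have hsum : Q * (2 + Λ) ≤ ∑ l, (c l : ℝ) * derivWithin (f l) (Icc a b) x := by
    calc Q * (2 + Λ) = Q * D * κ := by rw [hD]; field_simp
      _ ≤ Q * D * ∑ l, |derivWithin (f l) (Icc a b) x| := by gcongr; exact hκle x hx
      _ ≤ _ := by rw [Finset.mul_sum]; exact Finset.sum_le_sum fun l _ => hterm l
  set g : ℝ → ℝ := fun y => (w 0 : ℝ) + (∑ l, (c l : ℝ) * f l y) + lam y with hg
  set g' : ℝ → ℝ := fun y => (∑ l, (c l : ℝ) * derivWithin (f l) (Icc a b) y) +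
    derivWithin lam (Icc a b) y with hg'
  have hderiv : ∀ y ∈ Icc a b, HasDerivWithinAt g (g' y) (Icc a b) y := by
    intro y hy
    refine HasDerivWithinAt.add (HasDerivWithinAt.const_add _
      (HasDerivWithinAt.fun_sum fun l _ => HasDerivWithinAt.const_mul _ ?_)) ?_
    · exact ((hf l).differentiableOn (by exact_mod_cast (by omega : n ≠ 0)) y hy).hasDerivWithinAt
    · exact (hlam.differentiableOn (by norm_num) y hy).hasDerivWithinAt
  have hlow : ∀ y ∈ Icc (x - h) (x + h), Q ≤ g' y := by
    intro y hy
    have hyx : |y - x| ≤ r := (abs_le.mpr ⟨by linarith [hy.1], by linarith [hy.2]⟩).trans hhr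
    have h2 : |g' y - g' x| ≤ Q := by
      have : g' y - g' x = (∑ l, (c l : ℝ) * (derivWithin (f l) (Icc a b) y -
          derivWithin (f l) (Icc a b) x)) +
          (derivWithin lam (Icc a b) y - derivWithin lam (Icc a b) x) := by
        simp only [hg', mul_sub, Finset.sum_sub_distrib]
        ring
      rw [this]
      calc _ ≤ |∑ l, (c l : ℝ) * (derivWithin (f l) (Icc a b) y -
          derivWithin (f l) (Icc a b) x)| +
          |derivWithin lam (Icc a b) y - derivWithin lam (Icc a b) x| := abs_add_le _ _
        _ ≤ (∑ _l : Fin n, K * Q * ω) + Q * ω := by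
          refine add_le_add ((Finset.abs_sum_le_sum_abs _ _).trans
            (Finset.sum_le_sum fun l _ => ?_)) ?_
          · rw [abs_mul]
            exact mul_le_mul (hcle l) (hrfle l x hx y (hsub hy) (hyx.trans (hrle.2 l)))
              (abs_nonneg _) (by positivity)
          · refine (hrlle x hx y (hsub hy) (hyx.trans hrle.1)).trans ?_
            exact le_mul_of_one_le_left hω0.le hQ
        _ = Q := by
          rw [Finset.sum_const, Finset.card_univ, Fintype.card_fin, nsmul_eq_mul, hω]
          field_simp
    have h3 : 2 * Q ≤ g' x := by
      have h4 := (abs_le.mp (hΛ x hx)).1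
      have h5 : Λ ≤ Q * Λ := le_mul_of_one_le_left hΛ0 hQ
      simp only [hg']
      linarith
    linarith [(abs_le.mp h2).1]
  have hgx : |g x| ≤ Q * h := by
    have h2 : Q * h = K / Q ^ n := by rw [hh, pow_succ]; field_simp
    rw [h2, le_div_iff₀ (by positivity), mul_comm]
    refine h0.trans ?_
    linarith
  obtain ⟨α, hα, hzero⟩ := exists_zero_of_le_deriv hh0 hsub hderiv hlow hgx
  refine ⟨α, hα, w 0, c, ?_, hzero, hcle⟩
  rintro ⟨-, hc0⟩
  have : 0 < Q * (2 + Λ) := by positivity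
  simp only [hc0, Pi.zero_apply, Int.cast_zero, zero_mul, Finset.sum_const_zero] at hsum
  linarith

end Zeros

section Ubiquity

variable {n : ℕ} {a b : ℝ}

theorem exists_volume_short_vectors_le {f : Fin n → ℝ → ℝ} (hab : a < b)
    (hf : ∀ i, ContDiffOn ℝ n (f i) (Icc a b))
    (hW : ∀ x ∈ Icc a b,
      (Matrix.of fun i j : Fin n =>
        iteratedDerivWithin ((j : ℕ) + 1) (f i) (Icc a b) x).det ≠ 0) :
    ∃ ε > 0, ∃ θ > 0, θ ≤ 1 / 4 ∧ ∀ u v : ℝ, a ≤ u → u < v → v ≤ b → ∃ Q₀ : ℝ, ∀ Q ≥ Q₀,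
      volume {x ∈ Metric.closedBall ((u + v) / 2) (θ * (v - u)) |
        ¬ ∀ w : Fin (n + 1) → ℤ, w ≠ 0 →
          ε ≤ ‖Matrix.vecMul (fun j => (w j : ℝ)) (liftMatrix Q fun l => f l x)‖} ≤
        ENNReal.ofReal (θ * (v - u)) := by
  obtain ⟨r₀, hr₀, κ, hκ, M, hM, hU⟩ := exists_uniform_derivative hab hf hW
  set 𝒢 : Set (ℝ → ℝ) := {φ | IsComboSup a b f φ ∧ ContinuousOn φ (Icc a b)} with h𝒢
  obtain ⟨ε, hε, -, H⟩ := exists_volume_unmarked_le (r₀ := r₀) 𝒢 (fun φ hφ => hφ.2)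
    (fun δ hδ hδ1 => by
      obtain ⟨ε, hε, h⟩ := IsComboSup.exists_volume_le hab hf hM hU hδ hδ1
      exact ⟨ε, hε, fun φ hφ => h φ hφ.1⟩)
    (Submodule.finrank_strictMono (K := ℝ) (V := Fin (n + 1) → ℝ)) (n + 2) (1 / 2) (by norm_num)
    (by norm_num)
  have hab' : 0 < b - a := sub_pos.mpr hab
  set μ : ℝ := min (1 / 4) (r₀ / (2 * (b - a))) with hμ
  have hμ0 : 0 < μ := by positivity
  have h6 : (1 : ℝ) ≤ 6 ^ (n + 2) := one_le_pow₀ (by norm_num)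
  set θ : ℝ := μ / 6 ^ (n + 2) with hθ
  have hθ0 : 0 < θ := by positivity
  have hθμ : 6 ^ (n + 2) * θ = μ := by rw [hθ]; field_simp
  have hθ4 : θ ≤ 1 / 4 := by
    have : μ ≤ 1 / 4 := min_le_left _ _
    nlinarith
  refine ⟨ε / ((n + 1 : ℕ) + 1), by positivity, θ, hθ0, hθ4, fun u v hau huv hvb => ?_⟩
  have huv' : 0 < v - u := sub_pos.mpr huv
  set c : ℝ := (u + v) / 2 with hc
  set ρ : ℝ := θ * (v - u) with hρ
  have hρ0 : 0 < ρ := by positivity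
  have hbig : 6 ^ (n + 2) * ρ = μ * (v - u) := by rw [hρ, ← mul_assoc, hθμ]
  have hlen : 2 * (6 ^ (n + 2) * ρ) ≤ r₀ := by
    have h1 : μ ≤ r₀ / (2 * (b - a)) := min_le_right _ _
    rw [le_div_iff₀ (by positivity)] at h1
    rw [hbig]
    have h2 : μ * (v - u) ≤ μ * (b - a) := by gcongr
    linarith
  have hsub : Metric.closedBall c (6 ^ (n + 2) * ρ) ⊆ Icc a b := by
    have h1 : μ * (v - u) ≤ 1 / 4 * (v - u) := by gcongr; exact min_le_left _ _
    rw [hbig, Real.closedBall_eq_Icc]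
    exact Icc_subset_Icc (by linarith) (by linarith)
  have hρbig : ρ ≤ 6 ^ (n + 2) * ρ := le_mul_of_one_le_left hρ0.le h6
  have hsub' : Icc (c - ρ) (c + ρ) ⊆ Icc a b := by
    rw [← Real.closedBall_eq_Icc]
    exact (Metric.closedBall_subset_closedBall hρbig).trans hsub
  have hends := (Icc_subset_Icc_iff (by linarith)).mp hsub'
  obtain ⟨η, hη, hηle⟩ := exists_integer_combo_lower_bound hab hf hκ hU hends.1
    (by linarith : c - ρ < c + ρ) hends.2 (by linarith)
  rw [← Real.closedBall_eq_Icc] at hηle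
  refine ⟨max 1 (1 / η), fun Q hQ => ?_⟩
  have hQ1 : 1 ≤ Q := (le_max_left _ _).trans hQ
  have hQη : 1 ≤ η * Q := by
    have := (le_max_right 1 (1 / η)).trans hQ
    rwa [div_le_iff₀ hη, mul_comm] at this
  have hvol := H (Finset.range (n + 2)) (rationalSubspaces (n + 1))
    (fun W x => covolume W (liftMatrix Q fun l => f l x)) c ρ (Finset.card_range _)
    (fun W _ => by
      have := Submodule.finrank_le W
      rw [Module.finrank_fintype_fun_eq_card, Fintype.card_fin] at this
      exact Finset.mem_range.mpr (by omega))
    (fun W hW => by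
      obtain ⟨k, v, -, hv⟩ := exists_covolume_eq n.succ_pos hW
      simp only [hv]
      exact ⟨isComboSup_norm_minors f Q _,
        continuousOn_norm_minors (fun i => (hf i).continuousOn) Q _⟩)
    hρ0 hsub hlen
    (fun W hW => by
      obtain ⟨k, v, hbasis, hv⟩ := exists_covolume_eq n.succ_pos hW
      simp only [hv]
      exact exists_one_le_norm_minors ⟨c, Metric.mem_closedBall_self hρ0.le⟩ hηle hQ1 hQη v
        hbasis.1)
  rw [show 1 / 2 * (2 * ρ) = ρ by ring] at hvol
  refine le_trans (measure_mono ?_) hvol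
  refine fun x hx => ⟨hx.1, fun hmark => hx.2 fun w hw => ?_⟩
  rw [div_le_iff₀' (by positivity)]
  exact hmark.le_norm_vecMul n.succ_pos hw

/-- A set contained in a union of boundedly many small translates of another one has comparable
measure. -/
theorem volume_le_of_exists_translate {G U : Set ℝ} {A : ℕ} {τ : ℝ}
    (h : ∀ x ∈ G, ∃ j ∈ Finset.Icc (-(A : ℤ)) A, x - j * τ ∈ U) :
    volume G ≤ (2 * A + 1 : ℕ) * volume U := by
  have hsub : G ⊆ ⋃ j ∈ Finset.Icc (-(A : ℤ)) A, (fun x => x - j * τ) ⁻¹' U := fun x hx => by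
    obtain ⟨j, hj, hx⟩ := h x hx
    exact mem_biUnion hj hx
  calc volume G ≤ ∑ j ∈ Finset.Icc (-(A : ℤ)) A, volume ((fun x => x - j * τ) ⁻¹' U) :=
        (measure_mono hsub).trans (measure_biUnion_finset_le _ _)
    _ = ∑ _j ∈ Finset.Icc (-(A : ℤ)) A, volume U :=
        Finset.sum_congr rfl fun j _ => by simp only [sub_eq_add_neg, measure_preimage_add_right]
    _ = _ := by
        rw [Finset.sum_const, Int.card_Icc, nsmul_eq_mul]
        congr 2
        omega

theorem exists_int_sub_mem_ball {x α τ : ℝ} {A : ℕ} (hτ : 0 < τ) (h : |α - x| ≤ A * τ) :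
    ∃ j ∈ Finset.Icc (-(A : ℤ)) A, x - j * τ ∈ Metric.ball α τ := by
  have h' := abs_le.mp h
  refine ⟨⌊(x - α) / τ⌋, Finset.mem_Icc.mpr ⟨Int.le_floor.mpr ?_, ?_⟩, ?_⟩
  · rw [le_div_iff₀ hτ]
    push_cast
    linarith
  · rw [← Int.cast_le (R := ℝ)]
    refine (Int.floor_le _).trans ?_
    rw [div_le_iff₀ hτ]
    push_cast
    linarith
  · have h1 := Int.floor_le ((x - α) / τ)
    have h2 := Int.lt_floor_add_one ((x - α) / τ)
    rw [le_div_iff₀ hτ] at h1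
    rw [div_lt_iff₀ hτ] at h2
    rw [Metric.mem_ball, Real.dist_eq, abs_lt]
    constructor <;> linarith

end Ubiquity

theorem stmt_5 (n : ℕ) (hn : 1 ≤ n) (a b : ℝ) (hab : a < b)
    (f : Fin n → ℝ → ℝ) (hf : ∀ i, ContDiffOn ℝ n (f i) (Icc a b))
    (hW : ∀ x ∈ Icc a b,
      (Matrix.of fun i j : Fin n =>
        iteratedDerivWithin ((j : ℕ) + 1) (f i) (Icc a b) x).det ≠ 0)
    (lam : ℝ → ℝ) (hlam : ContDiffOn ℝ 2 lam (Icc a b)) :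
    ∃ k : ℝ, 0 < k ∧ ∀ u v : ℝ, a ≤ u → u < v → v ≤ b →
      ENNReal.ofReal (k * (v - u)) ≤
        liminf (fun t : ℕ =>
          volume ((⋃ α ∈ {α ∈ Icc a b | ∃ c₀ : ℤ, ∃ c : Fin n → ℤ,
                ¬(c₀ = 0 ∧ c = 0) ∧
                (c₀ : ℝ) + (∑ i, (c i : ℝ) * f i α) + lam α = 0 ∧
                (Finset.univ.sup fun i => (c i).natAbs) ≤ 2 ^ t},
              Metric.ball α (((2 : ℝ) ^ t) ^ (-((n : ℤ) + 1)))) ∩ Icc u v))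
          atTop := by
  obtain ⟨ε, hε, θ, hθ, hθ4, hshort⟩ := exists_volume_short_vectors_le hab hf hW
  obtain ⟨C, hC, r, hr, hzero⟩ := exists_near_zero hn hab hf hW hlam hε
  obtain ⟨A, hA⟩ := exists_nat_ge (C ^ (n + 2))
  refine ⟨θ / (2 * A + 1), by positivity, fun u v hau huv hvb => ?_⟩
  obtain ⟨Q₀, hQ₀⟩ := hshort u v hau huv hvb
  have huv' : 0 < v - u := sub_pos.mpr huv
  have hpow : Tendsto (fun t : ℕ => (2 : ℝ) ^ t) atTop atTop :=
    tendsto_pow_atTop_atTop_of_one_lt one_lt_two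
  have hzpow : ∀ x : ℝ, x ^ (-((n : ℤ) + 1)) = (x ^ (n + 1))⁻¹ := fun x => by
    rw [zpow_neg]
    norm_cast
  have hrad : Tendsto (fun t : ℕ => (A : ℝ) * ((2 : ℝ) ^ t) ^ (-((n : ℤ) + 1))) atTop (nhds 0) := by
    have h := ((tendsto_pow_atTop (n.succ_ne_zero)).comp hpow).inv_tendsto_atTop
    simp only [hzpow]
    simpa [Function.comp_def] using h.const_mul (A : ℝ)
  refine le_liminf_of_le (by isBoundedDefault) ?_
  filter_upwards [(hpow.atTop_div_const hC).eventually_ge_atTop (max 1 Q₀),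
    hrad.eventually_le_const (lt_min hr (by positivity : 0 < (v - u) / 4))] with t hQt hrt
  set τ : ℝ := ((2 : ℝ) ^ t) ^ (-((n : ℤ) + 1)) with hτ
  have hτ0 : 0 < τ := by positivity
  set Q : ℝ := 2 ^ t / C with hQ
  have hQ1 : 1 ≤ Q := (le_max_left _ _).trans hQt
  have hvol := hQ₀ Q ((le_max_right _ _).trans hQt)
  set U := (⋃ α ∈ {α ∈ Icc a b | ∃ c₀ : ℤ, ∃ c : Fin n → ℤ, ¬(c₀ = 0 ∧ c = 0) ∧
    (c₀ : ℝ) + (∑ i, (c i : ℝ) * f i α) + lam α = 0 ∧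
    (Finset.univ.sup fun i => (c i).natAbs) ≤ 2 ^ t}, Metric.ball α τ) ∩ Icc u v with hU
  set G : Set ℝ := {x ∈ Metric.closedBall ((u + v) / 2) (θ * (v - u)) |
    ∀ w : Fin (n + 1) → ℤ, w ≠ 0 →
      ε ≤ ‖Matrix.vecMul (fun j => (w j : ℝ)) (liftMatrix Q fun l => f l x)‖} with hG
  have hGU : volume G ≤ (2 * A + 1 : ℕ) * volume U := by
    refine volume_le_of_exists_translate (τ := τ) fun x hx => ?_
    set h : ℝ := C / Q ^ (n + 1) with hh
    have hhτ : h = C ^ (n + 2) * τ := by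
      rw [hh, hQ, hτ, hzpow, div_pow, pow_succ' C (n + 1)]
      field_simp
    have hhA : h ≤ A * τ := by rw [hhτ]; gcongr
    have hA4 : A * τ ≤ (v - u) / 4 := hrt.trans (min_le_right _ _)
    have hθuv : θ * (v - u) ≤ 1 / 4 * (v - u) := by gcongr
    have hx1 := hx.1
    rw [Real.closedBall_eq_Icc] at hx1
    obtain ⟨α, hα, c₀, c, hne, hα0, hcle⟩ := hzero Q x h hQ1 rfl
      (hhA.trans (hrt.trans (min_le_left _ _)))
      (Icc_subset_Icc (by linarith [hx1.1]) (by linarith [hx1.2])) hx.2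
    obtain ⟨j, hj, hjα⟩ := exists_int_sub_mem_ball (x := x) (α := α) (A := A) hτ0
      (abs_le.mpr ⟨by linarith [hα.1], by linarith [hα.2]⟩)
    refine ⟨j, hj, mem_biUnion (x := α) ⟨?_, c₀, c, hne, hα0, Finset.sup_le fun i _ => ?_⟩ hjα, ?_⟩
    · exact ⟨by linarith [hx1.1, hα.1], by linarith [hx1.2, hα.2]⟩
    · have h1 := hcle i
      rw [hQ, mul_div_cancel₀ _ hC.ne'] at h1
      rw [← Nat.cast_le (α := ℝ), Nat.cast_natAbs]
      push_cast
      exact h1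
    · have hj1 : (-(A : ℝ)) ≤ j := by exact_mod_cast (Finset.mem_Icc.mp hj).1
      have hj2 : (j : ℝ) ≤ A := by exact_mod_cast (Finset.mem_Icc.mp hj).2
      have h3 : j * τ ≤ A * τ := by gcongr
      have h4 : -(A * τ) ≤ j * τ := by rw [← neg_mul]; gcongr
      exact ⟨by linarith [hx1.1], by linarith [hx1.2]⟩
  have htotal : ENNReal.ofReal (2 * (θ * (v - u))) ≤
      (2 * A + 1 : ℕ) * volume U + ENNReal.ofReal (θ * (v - u)) := by
    rw [← Real.volume_closedBall]
    refine (measure_mono fun x hx => ?_).trans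
      ((measure_union_le G _).trans (add_le_add hGU hvol))
    by_cases hxG : x ∈ G
    · exact Or.inl hxG
    · exact Or.inr ⟨hx, fun h => hxG ⟨hx, h⟩⟩
  rw [two_mul, ENNReal.ofReal_add (by positivity) (by positivity)] at htotal
  have hfinal := ENNReal.le_of_add_le_add_right ENNReal.ofReal_ne_top htotal
  rw [show θ / (2 * A + 1) * (v - u) = θ * (v - u) / ((2 * A + 1 : ℕ) : ℝ) by push_cast; ring,
    ENNReal.ofReal_div_of_pos (by positivity), ENNReal.ofReal_natCast]
  exact ENNReal.div_le_of_le_mul' hfinal
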